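/- arXiv:1110.1003 — 2 statements merged into one kernel-verified Lean document; each statement's English description precedes it below -/
import Mathlib

section
/- Let k be an infinite cardinal and let X be an F_σδ-subset of the space B*(k) such that X does not belong to σLW(<k) + 𝒢_δσ. Then X contains a nowhere dense closed subset homeomorphic to Q(k)^ω. -/
open Topology Set Filter

universe u v

noncomputable section

/-- Strong zero-dimensionality (`Ind X = 0`): any two disjoint closed sets
can be separated by a clopen set. -/
def StronglyZeroDim (X : Type*) [TopologicalSpace X] : Prop :=
  ∀ A B : Set X, IsClosed A → IsClosed B → Disjoint A B →
    ∃ U : Set X, IsClopen U ∧ A ⊆ U ∧ Disjoint B U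

/-- The topological weight of a space: the least cardinality of a base. -/
def topWeight (X : Type u) [TopologicalSpace X] : Cardinal.{u} :=
  ⨅ B : {B : Set (Set X) // TopologicalSpace.IsTopologicalBasis B}, Cardinal.mk B.1

/-- The space has a base of cardinality `< k`. -/
def WeightLT (X : Type u) [TopologicalSpace X] (k : Cardinal.{u}) : Prop :=
  ∃ B : Set (Set X), TopologicalSpace.IsTopologicalBasis B ∧ Cardinal.mk B < k

/-- Every point has a neighborhood of weight `< k`. -/
def LocallyWeightLT (X : Type u) [TopologicalSpace X] (k : Cardinal.{u}) : Prop :=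
  ∀ x : X, ∃ s : Set X, s ∈ nhds x ∧ WeightLT ↥s k

/-- `X ∈ σLW(<k)`: `X` is a countable union of subspaces, each locally of weight `< k`. -/
def SigmaLW (X : Type u) [TopologicalSpace X] (k : Cardinal.{u}) : Prop :=
  ∃ S : ℕ → Set X, (⋃ n, S n) = Set.univ ∧ ∀ n, LocallyWeightLT ↥(S n) k

/-- A `G_δσ`-subset: a countable union of `G_δ`-sets. -/
def IsGdeltaSigma {Y : Type*} [TopologicalSpace Y] (s : Set Y) : Prop :=
  ∃ G : ℕ → Set Y, (∀ n, IsGδ (G n)) ∧ s = ⋃ n, G n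

/-- An `F_σ`-subset: a countable union of closed sets. -/
def IsFsigmaSet {Y : Type*} [TopologicalSpace Y] (s : Set Y) : Prop :=
  ∃ F : ℕ → Set Y, (∀ n, IsClosed (F n)) ∧ s = ⋃ n, F n

/-- An `F_σδ`-subset: a countable intersection of `F_σ`-sets. -/
def IsFsigmaDelta {Y : Type*} [TopologicalSpace Y] (s : Set Y) : Prop :=
  ∃ F : ℕ → Set Y, (∀ n, IsFsigmaSet (F n)) ∧ s = ⋂ n, F n

/-- An absolute `G_δσ`-set: a metrizable space whose image under every embedding
into a metrizable space is a countable union of `G_δ`-sets. -/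
def AbsGdeltaSigma (X : Type u) [TopologicalSpace X] : Prop :=
  TopologicalSpace.MetrizableSpace X ∧
    ∀ (Y : Type u) [TopologicalSpace Y] [TopologicalSpace.MetrizableSpace Y]
      (f : X → Y), Topology.IsEmbedding f → IsGdeltaSigma (Set.range f)

/-- An absolute `F_σδ`-set: a metrizable space whose image under every embedding
into a metrizable space is an `F_σδ`-set. -/
def AbsFsigmaDelta (X : Type u) [TopologicalSpace X] : Prop :=
  TopologicalSpace.MetrizableSpace X ∧
    ∀ (Y : Type u) [TopologicalSpace Y] [TopologicalSpace.MetrizableSpace Y]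
      (f : X → Y), Topology.IsEmbedding f → IsFsigmaDelta (Set.range f)

/-- `X ∈ σLW(<k) + 𝒢_δσ` : `X = A ∪ B` with `A ∈ σLW(<k)` and `B` an absolute
`G_δσ`-set. -/
def SLWplusGDS (X : Type u) [TopologicalSpace X] (k : Cardinal.{u}) : Prop :=
  ∃ A B : Set X, A ∪ B = Set.univ ∧ SigmaLW ↥A k ∧ AbsGdeltaSigma ↥B

/-- No nonempty open subspace is `σLW(<k) + 𝒢_δσ`. -/
def NowhereSLWplusGDS (X : Type u) [TopologicalSpace X] (k : Cardinal.{u}) : Prop :=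
  ∀ U : Set X, IsOpen U → U.Nonempty → ¬ SLWplusGDS ↥U k

/-- A space is of first category if it is meager in itself. -/
def FirstCategory (X : Type*) [TopologicalSpace X] : Prop :=
  IsMeagre (Set.univ : Set X)

/-- A Souslin (analytic) subset of a space:
`s = ⋃_{t ∈ ω^ω} ⋂_n F(t↾n)` for a family of closed sets indexed by finite tuples. -/
def IsSuslinIn {Y : Type*} [TopologicalSpace Y] (s : Set Y) : Prop :=
  ∃ F : List ℕ → Set Y, (∀ l, IsClosed (F l)) ∧
    s = ⋃ t : ℕ → ℕ, ⋂ n : ℕ, F (List.ofFn fun i : Fin n => t i)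

/-- An absolute Souslin space: metrizable, and Souslin in every completely metrizable
space into which it embeds. -/
def AbsSuslin (X : Type u) [TopologicalSpace X] : Prop :=
  TopologicalSpace.MetrizableSpace X ∧
    ∀ (Y : Type u) [MetricSpace Y] [CompleteSpace Y] (f : X → Y),
      Topology.IsEmbedding f → IsSuslinIn (Set.range f)

/-- An h-homogeneous space: every nonempty clopen subset is homeomorphic to the
whole space. -/
def HHomogeneous (X : Type*) [TopologicalSpace X] : Prop :=
  ∀ U : Set X, IsClopen U → U.Nonempty → Nonempty (↥U ≃ₜ X)

/-- A discrete family of sets: every point has a neighborhood meeting at most one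
member of the family. -/
def DiscreteFamily {X : Type*} [TopologicalSpace X] {ι : Type*} (f : ι → Set X) : Prop :=
  ∀ x : X, ∃ U ∈ nhds x, {i | (f i ∩ U).Nonempty}.Subsingleton

/-- A discrete space of cardinality `k`. -/
def DiscT (k : Cardinal.{u}) : Type u := k.out

instance (k : Cardinal.{u}) : TopologicalSpace (DiscT k) := ⊥
instance (k : Cardinal.{u}) : DiscreteTopology (DiscT k) := ⟨rfl⟩

/-- The Baire space `B(k) = k^ω`. -/
def BaireB (k : Cardinal.{u}) : Type u := ℕ → DiscT k

instance (k : Cardinal.{u}) : TopologicalSpace (BaireB k) :=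
  inferInstanceAs (TopologicalSpace (ℕ → DiscT k))

open Classical in
/-- The discrete factor of `B*(k)`: two points if `k = ℵ₀`, and `k` points otherwise. -/
def StarT (k : Cardinal.{u}) : Type u :=
  if k = Cardinal.aleph0 then ULift Bool else DiscT k

instance (k : Cardinal.{u}) : TopologicalSpace (StarT k) := ⊥
instance (k : Cardinal.{u}) : DiscreteTopology (StarT k) := ⟨rfl⟩

/-- `B*(k)`: the Cantor set `2^ω` if `k = ℵ₀`, and the Baire space `B(k)` if `k > ℵ₀`. -/
def BaireStar (k : Cardinal.{u}) : Type u := ℕ → StarT k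

instance (k : Cardinal.{u}) : TopologicalSpace (BaireStar k) :=
  inferInstanceAs (TopologicalSpace (ℕ → StarT k))

/-- A discrete space of cardinality `k` (for infinite `k`), with a distinguished basepoint. -/
def QBase (k : Cardinal.{u}) : Type u := DiscT k ⊕ PUnit.{u + 1}

instance (k : Cardinal.{u}) : TopologicalSpace (QBase k) := ⊥
instance (k : Cardinal.{u}) : DiscreteTopology (QBase k) := ⟨rfl⟩

/-- `Q(k)`: the σ-product of `ω` copies of a discrete space of cardinality `k`, i.e.
the subspace of the product consisting of the sequences eventually equal to the basepoint. -/
def Qk (k : Cardinal.{u}) : Type u :=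
  {x : ℕ → QBase k // ∀ᶠ n in Filter.atTop, x n = Sum.inr PUnit.unit}

instance (k : Cardinal.{u}) : TopologicalSpace (Qk k) :=
  inferInstanceAs (TopologicalSpace
    {x : ℕ → QBase k // ∀ᶠ n in Filter.atTop, x n = Sum.inr PUnit.unit})

/-- The countable power `Q(k)^ω`. -/
def QkOmega (k : Cardinal.{u}) : Type u := ℕ → Qk k

instance (k : Cardinal.{u}) : TopologicalSpace (QkOmega k) :=
  inferInstanceAs (TopologicalSpace (ℕ → Qk k))

/-- `Z` is homeomorphic to `Q(k)^ω`. -/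
def IsQkOmega (k : Cardinal.{u}) (Z : Type*) [TopologicalSpace Z] : Prop :=
  Nonempty (Z ≃ₜ QkOmega k)

/-- `Z` is homeomorphic to `A^{II}_k`, the complement in `B*(k)` of a dense copy of
`Q(k)^ω`. -/
def IsAII (k : Cardinal.{u}) (Z : Type*) [TopologicalSpace Z] : Prop :=
  ∃ A : Set (BaireStar k), Dense A ∧ IsQkOmega k ↥A ∧ Nonempty (Z ≃ₜ ↥(Aᶜ))

/-- `Z` is homeomorphic to `A^I_k = Q × A^{II}_k`. -/
def IsAI (k : Cardinal.{u}) (Z : Type*) [TopologicalSpace Z] : Prop :=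
  ∃ A : Set (BaireStar k), Dense A ∧ IsQkOmega k ↥A ∧ Nonempty (Z ≃ₜ (ℚ × ↥(Aᶜ)))

/-- `Z` is homeomorphic to `M^{II}_k`, the complement in `B*(k)` of a dense copy of
`A^I_k`. -/
def IsMII (k : Cardinal.{u}) (Z : Type*) [TopologicalSpace Z] : Prop :=
  ∃ Y : Set (BaireStar k), Dense Y ∧ IsAI k ↥Y ∧ Nonempty (Z ≃ₜ ↥(Yᶜ))

/-- `X ∈ 𝓕_σδ ∖ σLW(<k)`: `X` is homeomorphic to `F ∖ L` for some absolute
`F_σδ`-space `F` and some `L ⊆ F` with `L ∈ σLW(<k)`. -/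
def FsdMinusSLW (X : Type u) [TopologicalSpace X] (k : Cardinal.{u}) : Prop :=
  ∃ (F : TopCat.{u}) (L : Set F), AbsFsigmaDelta ↥F ∧ SigmaLW ↥L k ∧
    Nonempty (X ≃ₜ ↥(Lᶜ))

/-- No nonempty open subspace is in the class `𝓕_σδ ∖ σLW(<k)`. -/
def NowhereFsdMinusSLW (X : Type u) [TopologicalSpace X] (k : Cardinal.{u}) : Prop :=
  ∀ U : Set X, IsOpen U → U.Nonempty → ¬ FsdMinusSLW ↥U k

/-- A topologically complete (i.e. completely metrizable) space. -/
def CompletelyMetrizable (X : Type*) [t : TopologicalSpace X] : Prop :=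
  ∃ m : MetricSpace X, m.toUniformSpace.toTopologicalSpace = t ∧
    @CompleteSpace X m.toUniformSpace

end
section Helpers

open PiNat

/-- A point of an open set has a cylinder around it inside the set. -/
theorem exists_cyl_subset {T : Type u} [TopologicalSpace T] [DiscreteTopology T]
    {U : Set (ℕ → T)} (hU : IsOpen U) {y : ℕ → T} (hy : y ∈ U) : ∃ n, cylinder y n ⊆ U := by
  obtain ⟨s, ⟨x, n, rfl⟩, hys, hsU⟩ :=
    (isTopologicalBasis_cylinders (fun _ : ℕ => T)).exists_subset_of_mem_open hy hU
  refine ⟨n, ?_⟩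
  rw [mem_cylinder_iff_eq.1 hys]
  exact hsU

theorem isClosed_cyl {T : Type u} [TopologicalSpace T] [DiscreteTopology T]
    (y : ℕ → T) (n : ℕ) : IsClosed (cylinder y n) := by
  rw [cylinder_eq_pi]
  exact isClosed_set_pi fun i _ => isClosed_discrete _

/-- The trace on `A` of the cylinders centered at points of `A`. -/
def cylTrace {T : Type u} (A : Set (ℕ → T)) : Set (Set (ℕ → T)) :=
  {C | ∃ y ∈ A, ∃ n, C = cylinder y n ∩ A}

/-- Weight less than `k`, in terms of cylinders. -/
def WLT {T : Type u} (k : Cardinal.{u}) (A : Set (ℕ → T)) : Prop :=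
  Cardinal.mk (cylTrace A) < k

theorem WLT.mono {T : Type u} {k : Cardinal.{u}} {A B : Set (ℕ → T)} (h : WLT k B) (hAB : A ⊆ B) :
    WLT k A := by
  refine lt_of_le_of_lt ?_ h
  have : cylTrace A ⊆ (fun C => C ∩ A) '' cylTrace B := by
    rintro C ⟨y, hy, n, rfl⟩
    refine ⟨cylinder y n ∩ B, ⟨y, hAB hy, n, rfl⟩, ?_⟩
    ext z; simp only [mem_inter_iff]; constructor
    · rintro ⟨⟨a, b⟩, c⟩; exact ⟨a, c⟩
    · rintro ⟨a, c⟩; exact ⟨⟨a, hAB c⟩, c⟩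
  exact (Cardinal.mk_le_mk_of_subset this).trans Cardinal.mk_image_le

theorem weightLT_of_WLT {T : Type u} [TopologicalSpace T] [DiscreteTopology T] {k : Cardinal.{u}}
    {A : Set (ℕ → T)} (h : WLT k A) {W : Type u} [TopologicalSpace W] (g : W → ℕ → T)
    (hg : IsInducing g) (hgA : range g ⊆ A) : WeightLT W k := by
  have h' := h.mono hgA
  refine ⟨(fun C => g ⁻¹' C) '' cylTrace (range g), ?_, lt_of_le_of_lt Cardinal.mk_image_le h'⟩
  apply TopologicalSpace.isTopologicalBasis_of_isOpen_of_nhds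
  · rintro _ ⟨_, ⟨y, hy, n, rfl⟩, rfl⟩
    have : g ⁻¹' (cylinder y n ∩ range g) = g ⁻¹' (cylinder y n) := by
      ext w; simp
    simp only [this]
    exact (isOpen_cylinder (fun _ => T) y n).preimage hg.continuous
  · intro w O hw hO
    obtain ⟨V, hV, rfl⟩ := hg.isOpen_iff.1 hO
    obtain ⟨n, hn⟩ := exists_cyl_subset hV hw
    refine ⟨_, ⟨_, ⟨g w, ⟨w, rfl⟩, n, rfl⟩, rfl⟩, ⟨self_mem_cylinder _ _, w, rfl⟩, ?_⟩
    intro w' hw'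
    exact hn hw'.1

/-- Locally of weight less than `k`. -/
def LWS {T : Type u} [TopologicalSpace T] (k : Cardinal.{u}) (L : Set (ℕ → T)) : Prop :=
  ∀ x ∈ L, ∃ U, IsOpen U ∧ x ∈ U ∧ WLT k (L ∩ U)

/-- The σ-ideal of small sets. -/
def SmallS {T : Type u} [TopologicalSpace T] (k : Cardinal.{u}) (X A : Set (ℕ → T)) : Prop :=
  ∃ L G : ℕ → Set (ℕ → T), (∀ n, LWS k (L n)) ∧ (∀ n, IsGδ (G n)) ∧ (∀ n, G n ⊆ X) ∧
    A ⊆ ⋃ n, (L n ∪ G n)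

theorem SmallS.mono {T : Type u} [TopologicalSpace T] {k : Cardinal.{u}} {X A B : Set (ℕ → T)}
    (h : SmallS k X B) (hAB : A ⊆ B) : SmallS k X A := by
  obtain ⟨L, G, a, b, c, d⟩ := h
  exact ⟨L, G, a, b, c, hAB.trans d⟩

theorem SmallS.iUnion {T : Type u} [TopologicalSpace T] {k : Cardinal.{u}} {X : Set (ℕ → T)}
    {A : ℕ → Set (ℕ → T)} (h : ∀ n, SmallS k X (A n)) : SmallS k X (⋃ n, A n) := by
  choose L G a b c d using h
  refine ⟨fun p => L p.unpair.1 p.unpair.2, fun p => G p.unpair.1 p.unpair.2, fun p => a _ _,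
    fun p => b _ _, fun p => c _ _, ?_⟩
  apply iUnion_subset
  intro n x hx
  obtain ⟨m, hm⟩ := mem_iUnion.1 (d n hx)
  refine mem_iUnion.2 ⟨Nat.pair n m, ?_⟩
  simpa using hm

theorem SmallS.union {T : Type u} [TopologicalSpace T] {k : Cardinal.{u}} {X A B : Set (ℕ → T)}
    (hA : SmallS k X A) (hB : SmallS k X B) : SmallS k X (A ∪ B) := by
  have := SmallS.iUnion (k := k) (X := X) (A := fun n : ℕ => if n = 0 then A else B)
    (by intro n; split_ifs <;> assumption)
  refine this.mono ?_
  rintro x (h | h)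
  · exact mem_iUnion.2 ⟨0, by simpa using h⟩
  · exact mem_iUnion.2 ⟨1, by simpa using h⟩

theorem LWS.empty {T : Type u} [TopologicalSpace T] {k : Cardinal.{u}} :
    LWS k (∅ : Set (ℕ → T)) := by
  intro _ hx; exact hx.elim

theorem SmallS.of_isGδ {T : Type u} [TopologicalSpace T] {k : Cardinal.{u}} {X A : Set (ℕ → T)}
    (hA : IsGδ A) (h : A ⊆ X) : SmallS k X A :=
  ⟨fun _ => ∅, fun _ => A, fun _ => LWS.empty, fun _ => hA, fun _ => h,
    fun x hx => mem_iUnion.2 ⟨0, Or.inr hx⟩⟩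

/-- A disjoint open union of `Gδ` sets is `Gδ`. -/
theorem isGδ_disjoint_union {Y : Type u} [TopologicalSpace Y] (𝒞 : Set (Set Y))
    (ho : ∀ C ∈ 𝒞, IsOpen C) (hd : ∀ C ∈ 𝒞, ∀ D ∈ 𝒞, (C ∩ D).Nonempty → C = D)
    (E : 𝒞 → Set Y) (hE : ∀ C, IsGδ (E C)) : IsGδ (⋃ C : 𝒞, E C ∩ C.1) := by
  choose O hO hEO using fun C => (hE C).eq_iInter_nat
  have : (⋃ C : 𝒞, E C ∩ C.1) = ⋂ m, ⋃ C : 𝒞, O C m ∩ C.1 := by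
    ext x
    simp only [mem_iUnion, mem_iInter, mem_inter_iff]
    constructor
    · rintro ⟨C, hx, hxC⟩ m
      rw [hEO C] at hx
      exact ⟨C, mem_iInter.1 hx m, hxC⟩
    · intro h
      obtain ⟨C, -, hC⟩ := h 0
      refine ⟨C, ?_, hC⟩
      rw [hEO C]
      refine mem_iInter.2 fun m => ?_
      obtain ⟨D, hD, hxD⟩ := h m
      have : C = D := Subtype.ext (hd C.1 C.2 D.1 D.2 ⟨x, hC, hxD⟩)
      rw [this]; exact hD
  rw [this]
  exact IsGδ.iInter_of_isOpen fun m => isOpen_iUnion fun C => (hO C m).inter (ho C.1 C.2)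

theorem SmallS.disjoint_union {T : Type u} [TopologicalSpace T] {k : Cardinal.{u}}
    {X : Set (ℕ → T)} (𝒞 : Set (Set (ℕ → T)))
    (ho : ∀ C ∈ 𝒞, IsOpen C) (hd : ∀ C ∈ 𝒞, ∀ D ∈ 𝒞, (C ∩ D).Nonempty → C = D)
    (A : 𝒞 → Set (ℕ → T)) (hA : ∀ C, SmallS k X (A C)) : SmallS k X (⋃ C : 𝒞, A C ∩ C.1) := by
  choose L G a b c d using hA
  refine ⟨fun n => ⋃ C : 𝒞, L C n ∩ C.1, fun n => ⋃ C : 𝒞, G C n ∩ C.1, ?_, ?_, ?_, ?_⟩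
  · intro n x hx
    obtain ⟨C, hx, hxC⟩ := mem_iUnion.1 hx
    obtain ⟨U, hU, hxU, hw⟩ := a C n x hx
    refine ⟨U ∩ C.1, hU.inter (ho C.1 C.2), ⟨hxU, hxC⟩, hw.mono ?_⟩
    rintro z ⟨hz, hzU, hzC⟩
    obtain ⟨D, hz, hzD⟩ := mem_iUnion.1 hz
    have : D = C := Subtype.ext (hd D.1 D.2 C.1 C.2 ⟨z, hzD, hzC⟩)
    subst this
    exact ⟨hz, hzU⟩
  · exact fun n => isGδ_disjoint_union 𝒞 ho hd _ fun C => b C n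
  · exact fun n => iUnion_subset fun C => inter_subset_left.trans (c C n)
  · apply iUnion_subset
    rintro C x ⟨hx, hxC⟩
    obtain ⟨n, hn⟩ := mem_iUnion.1 (d C hx)
    refine mem_iUnion.2 ⟨n, ?_⟩
    rcases hn with hn | hn
    · exact Or.inl (mem_iUnion.2 ⟨C, hn, hxC⟩)
    · exact Or.inr (mem_iUnion.2 ⟨C, hn, hxC⟩)

/-- Any union of open sets is refined by a disjoint family of cylinders. -/
theorem exists_disjoint_refinement {T : Type u} [TopologicalSpace T] [DiscreteTopology T]
    (𝒪 : Set (Set (ℕ → T))) (ho : ∀ O ∈ 𝒪, IsOpen O) :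
    ∃ 𝒞 : Set (Set (ℕ → T)), (∀ C ∈ 𝒞, IsOpen C) ∧
      (∀ C ∈ 𝒞, ∀ D ∈ 𝒞, (C ∩ D).Nonempty → C = D) ∧ (∀ C ∈ 𝒞, ∃ O ∈ 𝒪, C ⊆ O) ∧
      ⋃₀ 𝒪 ⊆ ⋃₀ 𝒞 := by
  classical
  refine ⟨{C | ∃ y n, C = cylinder y n ∧ (∃ O ∈ 𝒪, cylinder y n ⊆ O) ∧
    ∀ m < n, ¬ ∃ O ∈ 𝒪, cylinder y m ⊆ O}, ?_, ?_, ?_, ?_⟩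
  · rintro _ ⟨y, n, rfl, -⟩; exact isOpen_cylinder (fun _ => T) y n
  · rintro _ ⟨y, n, rfl, h1, h2⟩ _ ⟨y', n', rfl, h1', h2'⟩ ⟨z, hz, hz'⟩
    have e1 : ∀ m ≤ n, cylinder y m = cylinder z m := fun m hm =>
      (mem_cylinder_iff_eq.1 (cylinder_anti y hm hz)).symm
    have e2 : ∀ m ≤ n', cylinder y' m = cylinder z m := fun m hm =>
      (mem_cylinder_iff_eq.1 (cylinder_anti y' hm hz')).symm
    have : n = n' := by
      rcases lt_trichotomy n n' with h | h | h
      · exact absurd (by rw [e2 n h.le, ← e1 n le_rfl]; exact h1) (h2' n h)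
      · exact h
      · exact absurd (by rw [e1 n' h.le, ← e2 n' le_rfl]; exact h1') (h2 n' h)
    subst this
    rw [e1 n le_rfl, e2 n le_rfl]
  · rintro _ ⟨y, n, rfl, h, -⟩; exact h
  · rintro y ⟨O, hO, hy⟩
    obtain ⟨n, hn⟩ := exists_cyl_subset (ho O hO) hy
    have hex : ∃ n, ∃ O ∈ 𝒪, cylinder y n ⊆ O := ⟨n, O, hO, hn⟩
    exact ⟨cylinder y (Nat.find hex), ⟨y, _, rfl, Nat.find_spec hex, fun m hm => Nat.find_min hex hm⟩,
      self_mem_cylinder _ _⟩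

/-- An absolute `Gδ` statement. -/
theorem isGδ_range_of_embedding {T : Type u} [TopologicalSpace T] [DiscreteTopology T]
    {W : Type u} [TopologicalSpace W] {Y : Type u} [TopologicalSpace Y]
    [TopologicalSpace.MetrizableSpace Y] (g : W → ℕ → T) (hg : IsInducing g)
    (hgδ : IsGδ (range g)) (f : W → Y) (hf : IsEmbedding f) : IsGδ (range f) := by
  obtain ⟨O, hO, hgO⟩ := hgδ.eq_iInter_nat
  have hgO' : ∀ w n, g w ∈ O n := fun w n => mem_iInter.1 (hgO ▸ mem_range_self w) n
  let Wn : ℕ → Set Y := fun n => ⋃₀ {V | IsOpen V ∧ ∃ y m, n ≤ m ∧ cylinder y m ⊆ O n ∧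
    ∀ w, f w ∈ V → g w ∈ cylinder y m}
  have hWo : ∀ n, IsOpen (Wn n) := fun n => isOpen_sUnion fun V hV => hV.1
  have key : range f = closure (range f) ∩ ⋂ n, Wn n := by
    apply Subset.antisymm
    · rintro _ ⟨w, rfl⟩
      refine ⟨subset_closure ⟨w, rfl⟩, mem_iInter.2 fun n => ?_⟩
      obtain ⟨m, hm⟩ := exists_cyl_subset (hO n) (hgO' w n)
      have ho : IsOpen (g ⁻¹' cylinder (g w) (max m n)) :=
        (isOpen_cylinder (fun _ => T) _ _).preimage hg.continuous
      obtain ⟨V, hV, hVe⟩ := hf.isInducing.isOpen_iff.1 ho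
      refine ⟨V, ⟨hV, g w, max m n, le_max_right _ _,
        (cylinder_anti _ (le_max_left _ _)).trans hm, ?_⟩, ?_⟩
      · intro w' hw'
        have : w' ∈ f ⁻¹' V := hw'
        rw [hVe] at this; exact this
      · have : w ∈ f ⁻¹' V := by rw [hVe]; exact self_mem_cylinder _ _
        exact this
    · rintro q ⟨hq, hqW⟩
      have hqW' : ∀ n, ∃ V, (IsOpen V ∧ ∃ y m, n ≤ m ∧ cylinder y m ⊆ O n ∧
          ∀ w, f w ∈ V → g w ∈ cylinder y m) ∧ q ∈ V := fun n => mem_iInter.1 hqW n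
      choose V hV hqV using hqW'
      choose hVo ys ms hnm hcO hcyl using hV
      have hmeet : ∀ n n', ∃ w, g w ∈ cylinder (ys n) (ms n) ∧ g w ∈ cylinder (ys n') (ms n') := by
        intro n n'
        obtain ⟨_, ⟨h1, h2⟩, w, rfl⟩ := mem_closure_iff.1 hq (V n ∩ V n')
          ((hVo n).inter (hVo n')) ⟨hqV n, hqV n'⟩
        exact ⟨w, hcyl n w h1, hcyl n' w h2⟩
      let y : ℕ → T := fun i => ys (i + 1) i
      have hy : ∀ n, y ∈ cylinder (ys n) (ms n) := by
        intro n i hi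
        obtain ⟨w, h1, h2⟩ := hmeet n (i + 1)
        have := hnm (i + 1)
        change ys (i + 1) i = ys n i
        rw [← h1 i hi, h2 i (by omega)]
      have : y ∈ range g := by
        rw [hgO]; exact mem_iInter.2 fun n => hcO n (hy n)
      obtain ⟨w0, hw0⟩ := this
      refine ⟨w0, ?_⟩
      by_contra hne
      obtain ⟨A, B, hA, hB, hwA, hqB, hAB⟩ := t2_separation hne
      obtain ⟨A', hA', hAe⟩ := hg.isOpen_iff.1 (hA.preimage hf.continuous)
      have hw0A : w0 ∈ g ⁻¹' A' := by rw [hAe]; exact hwA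
      obtain ⟨m, hm⟩ := exists_cyl_subset hA' hw0A
      obtain ⟨_, ⟨h1, h2⟩, w, rfl⟩ := mem_closure_iff.1 hq (V m ∩ B)
          ((hVo m).inter hB) ⟨hqV m, hqB⟩
      have h3 := hcyl m w h1
      have h4 : g w ∈ cylinder (g w0) m := by
        rw [hw0]
        refine cylinder_anti y (hnm m) ?_
        rw [mem_cylinder_iff_eq.1 (hy m)]; exact h3
      have h5 : w ∈ g ⁻¹' A' := hm h4
      rw [hAe] at h5
      exact disjoint_left.1 hAB h5 h2
  let _ := TopologicalSpace.metrizableSpaceMetric Y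
  rw [key]
  exact isClosed_closure.isGδ.inter (IsGδ.iInter_of_isOpen hWo)

theorem SLWplusGDS_of_small {T : Type u} [TopologicalSpace T] [DiscreteTopology T]
    {k : Cardinal.{u}} {X : Set (ℕ → T)} (h : SmallS k X X) : SLWplusGDS ↥X k := by
  obtain ⟨L, G, hL, hG, hGX, hX⟩ := h
  have hemb : ∀ {W : Type u} [TopologicalSpace W] (s : Set W), IsInducing (Subtype.val : s → W) :=
    fun s => IsInducing.subtypeVal
  refine ⟨{x | x.1 ∈ ⋃ n, L n}, {x | x.1 ∈ ⋃ n, G n}, ?_, ?_, ?_, ?_⟩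
  · rw [eq_univ_iff_forall]
    intro x
    obtain ⟨n, hn | hn⟩ := mem_iUnion.1 (hX x.2)
    · exact Or.inl (mem_iUnion.2 ⟨n, hn⟩)
    · exact Or.inr (mem_iUnion.2 ⟨n, hn⟩)
  · refine ⟨fun n => {a | a.1.1 ∈ L n}, ?_, ?_⟩
    · rw [eq_univ_iff_forall]
      rintro ⟨x, hx⟩
      obtain ⟨n, hn⟩ := mem_iUnion.1 hx
      exact mem_iUnion.2 ⟨n, hn⟩
    · rintro n ⟨x, hx⟩
      obtain ⟨U, hU, hxU, hw⟩ := hL n x.1.1 hx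
      refine ⟨{z | z.1.1.1 ∈ U}, ?_, ?_⟩
      · refine IsOpen.mem_nhds ?_ hxU
        exact hU.preimage (by fun_prop)
      · refine weightLT_of_WLT hw (fun z => z.1.1.1.1)
          ((hemb _).comp ((hemb _).comp ((hemb _).comp (hemb _)))) ?_
        rintro _ ⟨z, rfl⟩
        exact ⟨z.1.2, z.2⟩
  · have : TopologicalSpace.MetrizableSpace (ℕ → T) := inferInstance
    infer_instance
  · intro Y _ _ f hf
    refine ⟨fun n => range (fun z : {b : {x : X | x.1 ∈ ⋃ n, G n} | b.1.1 ∈ G n} => f z.1), ?_, ?_⟩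
    · intro n
      refine isGδ_range_of_embedding (fun z => z.1.1.1) ((hemb _).comp ((hemb _).comp (hemb _))) ?_
        _ (hf.comp IsEmbedding.subtypeVal)
      convert hG n using 1
      ext y; constructor
      · rintro ⟨z, rfl⟩; exact z.2
      · intro hy
        exact ⟨⟨⟨⟨y, hGX n hy⟩, mem_iUnion.2 ⟨n, hy⟩⟩, hy⟩, rfl⟩
    · ext y; constructor
      · rintro ⟨b, rfl⟩
        obtain ⟨n, hn⟩ := mem_iUnion.1 b.2
        exact mem_iUnion.2 ⟨n, ⟨b, hn⟩, rfl⟩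
      · intro hy
        obtain ⟨n, z, rfl⟩ := mem_iUnion.1 hy
        exact ⟨_, rfl⟩

/-- The cylinders of level `n` meeting `B`. -/
def cylLevel {T : Type u} (B : Set (ℕ → T)) (n : ℕ) : Set (Set (ℕ → T)) :=
  (fun y => cylinder y n) '' B

theorem mk_cylLevel_mono {T : Type u} (B : Set (ℕ → T)) {m n : ℕ} (h : m ≤ n) :
    Cardinal.mk (cylLevel B m) ≤ Cardinal.mk (cylLevel B n) := by
  classical
  have hsub : cylLevel B m ⊆
      (fun C : Set (ℕ → T) => {z | ∃ y ∈ C, z ∈ cylinder y m}) '' cylLevel B n := by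
    rintro _ ⟨y, hy, rfl⟩
    refine ⟨cylinder y n, ⟨y, hy, rfl⟩, ?_⟩
    ext z
    constructor
    · rintro ⟨y', hy', hz⟩
      have := mem_cylinder_iff_eq.1 (cylinder_anti y h hy')
      rw [this] at hz; exact hz
    · intro hz
      exact ⟨y, self_mem_cylinder _ _, hz⟩
  exact (Cardinal.mk_le_mk_of_subset hsub).trans Cardinal.mk_image_le

theorem exists_level_gt {T : Type u} {k : Cardinal.{u}} (hk : Cardinal.aleph0 < k)
    {B : Set (ℕ → T)} (hB : ¬ WLT k B) (l : ℕ) {κ : Cardinal.{u}} (hκ : κ < k) :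
    ∃ n, l ≤ n ∧ κ < Cardinal.mk (cylLevel B n) := by
  by_contra hcon
  push Not at hcon
  apply hB
  have hle : ∀ n, Cardinal.mk (cylLevel B n) ≤ max κ Cardinal.aleph0 := fun n =>
    ((mk_cylLevel_mono B (le_max_left n l)).trans (hcon _ (le_max_right n l))).trans
      (le_max_left _ _)
  have hsub : cylTrace B ⊆ ⋃ n : ULift.{u} ℕ, (fun C => C ∩ B) '' cylLevel B n.down := by
    rintro _ ⟨y, hy, n, rfl⟩
    exact mem_iUnion.2 ⟨⟨n⟩, _, ⟨y, hy, rfl⟩, rfl⟩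
  refine lt_of_le_of_lt (Cardinal.mk_le_mk_of_subset hsub) ?_
  refine lt_of_le_of_lt (Cardinal.mk_iUnion_le _) ?_
  refine lt_of_le_of_lt (b := Cardinal.aleph0 * max κ Cardinal.aleph0) ?_ ?_
  · refine mul_le_mul' (by simp) ?_
    exact ciSup_le' fun n => Cardinal.mk_image_le.trans (hle _)
  · rw [Cardinal.mul_eq_max le_rfl (le_max_right _ _)]
    exact max_lt hk (max_lt hκ hk)

/-- Splitting lemma for uncountable `k`. -/
theorem exists_split {T : Type u} [TopologicalSpace T] [DiscreteTopology T] {k : Cardinal.{u}}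
    (hk : Cardinal.aleph0 < k) {Z : Set (ℕ → T)}
    (hZ : ∀ U, IsOpen U → (U ∩ Z).Nonempty → ¬ WLT k (Z ∩ U))
    {V : Set (ℕ → T)} (hV : IsOpen V) (hVZ : (V ∩ Z).Nonempty) :
    ∃ 𝒟 : Set (Set (ℕ → T)), k ≤ Cardinal.mk 𝒟 ∧
      (∀ D ∈ 𝒟, IsClopen D ∧ D ⊆ V ∧ (D ∩ Z).Nonempty) ∧
      ∀ y, ∃ n, ∀ D ∈ 𝒟, ∀ D' ∈ 𝒟, (D ∩ cylinder y n).Nonempty → (D' ∩ cylinder y n).Nonempty →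
        D = D' := by
  obtain ⟨v, hvV, hvZ⟩ := hVZ
  obtain ⟨l, hl⟩ := exists_cyl_subset hV hvV
  have hclop : ∀ (y : ℕ → T) n, IsClopen (cylinder y n) := fun y n =>
    ⟨isClosed_cyl y n, isOpen_cylinder (fun _ => T) y n⟩
  have hbig : ∀ (y : ℕ → T) n, y ∈ Z → ¬ WLT k (Z ∩ cylinder y n) := fun y n hy =>
    hZ _ (hclop y n).2 ⟨y, self_mem_cylinder _ _, hy⟩
  by_cases hc : ∃ n, l ≤ n ∧ k ≤ Cardinal.mk (cylLevel (Z ∩ cylinder v l) n)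
  · obtain ⟨n, hln, hn⟩ := hc
    refine ⟨_, hn, ?_, ?_⟩
    · rintro _ ⟨y, ⟨hyZ, hyl⟩, rfl⟩
      refine ⟨hclop _ _, ?_, y, self_mem_cylinder _ _, hyZ⟩
      refine (cylinder_anti y hln).trans (Subset.trans ?_ hl)
      rw [mem_cylinder_iff_eq.1 hyl]
    · intro y
      refine ⟨n, ?_⟩
      rintro _ ⟨z, -, rfl⟩ _ ⟨z', -, rfl⟩ ⟨a, ha, ha'⟩ ⟨b, hb, hb'⟩
      simp only at *
      rw [← mem_cylinder_iff_eq.1 ha, ← mem_cylinder_iff_eq.1 hb, mem_cylinder_iff_eq.1 ha',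
        mem_cylinder_iff_eq.1 hb']
  · push Not at hc
    obtain ⟨p, hlp, hp⟩ := exists_level_gt hk (hbig v l hvZ) l hk
    have hinf : Infinite ↥(cylLevel (Z ∩ cylinder v l) p) := Cardinal.infinite_iff.2 hp.le
    let e := Infinite.natEmbedding ↥(cylLevel (Z ∩ cylinder v l) p)
    have he : ∀ i, ∃ y ∈ Z ∩ cylinder v l, cylinder y p = (e i).1 := fun i => (e i).2
    choose ys hys hyse using he
    have hsel : ∀ i, ∃ n, p ≤ n ∧ Cardinal.mk (cylLevel (Z ∩ cylinder v l) (l + i)) <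
        Cardinal.mk (cylLevel (Z ∩ cylinder (ys i) p) n) := fun i =>
      exists_level_gt hk (hbig _ _ (hys i).1) p (hc _ (Nat.le_add_right _ _))
    choose ns hpn hns using hsel
    have hij : ∀ i j, ∀ z, z ∈ cylinder (ys i) p → z ∈ cylinder (ys j) p → i = j := by
      intro i j z hi hj
      apply e.injective
      apply Subtype.ext
      rw [← hyse, ← hyse, ← mem_cylinder_iff_eq.1 hi, ← mem_cylinder_iff_eq.1 hj]
    refine ⟨⋃ i, cylLevel (Z ∩ cylinder (ys i) p) (ns i), ?_, ?_, ?_⟩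
    · refine le_of_forall_lt fun κ hκ => ?_
      obtain ⟨n, hln, hn⟩ := exists_level_gt hk (hbig v l hvZ) l hκ
      obtain ⟨i, rfl⟩ := Nat.exists_eq_add_of_le hln
      exact (hn.trans (hns i)).trans_le (Cardinal.mk_le_mk_of_subset (subset_iUnion_of_subset i
        (Subset.refl _)))
    · intro D hD
      obtain ⟨i, y, ⟨hyZ, hyi⟩, rfl⟩ := mem_iUnion.1 hD
      refine ⟨hclop _ _, ?_, y, self_mem_cylinder _ _, hyZ⟩
      refine (cylinder_anti y (hpn i)).trans ?_
      rw [mem_cylinder_iff_eq.1 hyi]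
      refine (cylinder_anti _ hlp).trans (Subset.trans ?_ hl)
      rw [mem_cylinder_iff_eq.1 (hys i).2]
    · intro y
      have hsubD : ∀ i, ∀ D ∈ cylLevel (Z ∩ cylinder (ys i) p) (ns i), D ⊆ cylinder (ys i) p := by
        rintro i _ ⟨y, ⟨hyZ, hyi⟩, rfl⟩
        refine (cylinder_anti y (hpn i)).trans ?_
        rw [mem_cylinder_iff_eq.1 hyi]
      by_cases hy : ∃ i, y ∈ cylinder (ys i) p
      · obtain ⟨i, hi⟩ := hy
        have hci : cylinder y (ns i) ⊆ cylinder (ys i) p := by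
          refine (cylinder_anti y (hpn i)).trans ?_
          rw [mem_cylinder_iff_eq.1 hi]
        have hD1 : ∀ D ∈ ⋃ i, cylLevel (Z ∩ cylinder (ys i) p) (ns i),
            (D ∩ cylinder y (ns i)).Nonempty → D = cylinder y (ns i) := by
          rintro D hD ⟨z, hzD, hzy⟩
          obtain ⟨j, hD⟩ := mem_iUnion.1 hD
          have := hij i j z (hci hzy) (hsubD j D hD hzD)
          subst this
          obtain ⟨y', -, rfl⟩ := hD
          simp only at *
          rw [← mem_cylinder_iff_eq.1 hzD, mem_cylinder_iff_eq.1 hzy]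
        refine ⟨ns i, fun D hD D' hD' h h' => ?_⟩
        rw [hD1 D hD h, hD1 D' hD' h']
      · refine ⟨p, fun D hD D' hD' h h' => ?_⟩
        exfalso
        obtain ⟨z, hzD, hzy⟩ := h
        obtain ⟨j, hD⟩ := mem_iUnion.1 hD
        refine hy ⟨j, ?_⟩
        have h1 := hsubD j D hD hzD
        rw [← mem_cylinder_iff_eq.1 h1, mem_cylinder_iff_eq.1 hzy]
        exact self_mem_cylinder _ _

/-- Splitting lemma, indexed by `T`. -/
theorem exists_split_family {T : Type u} [TopologicalSpace T] [DiscreteTopology T]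
    {k : Cardinal.{u}} {o : T}
    (hT : (∀ a b : T, a ≠ o → b ≠ o → a = b) ∨ (Cardinal.aleph0 < k ∧ Cardinal.mk T ≤ k))
    {Z : Set (ℕ → T)} (hZ : ∀ U, IsOpen U → (U ∩ Z).Nonempty → ¬ WLT k (Z ∩ U))
    {V : Set (ℕ → T)} (hV : IsOpen V) (hVZ : (V ∩ Z).Nonempty) :
    ∃ D : T → Set (ℕ → T), (∀ a, IsClopen (D a) ∧ D a ⊆ V ∧ (D a ∩ Z).Nonempty) ∧
      ∀ y, ∃ n, ∀ a b, a ≠ o → b ≠ o → (D a ∩ cylinder y n).Nonempty →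
        (D b ∩ cylinder y n).Nonempty → a = b := by
  rcases hT with hT | ⟨hk, hT⟩
  · obtain ⟨v, hvV, hvZ⟩ := hVZ
    obtain ⟨l, hl⟩ := exists_cyl_subset hV hvV
    exact ⟨fun _ => cylinder v l, fun _ => ⟨⟨isClosed_cyl v l, isOpen_cylinder (fun _ => T) v l⟩,
      hl, v, self_mem_cylinder _ _, hvZ⟩, fun y => ⟨0, fun a b ha hb _ _ => hT a b ha hb⟩⟩
  · obtain ⟨𝒟, hc, h1, h2⟩ := exists_split hk hZ hV hVZ
    obtain ⟨e⟩ := Cardinal.le_def T 𝒟 |>.1 (hT.trans hc)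
    refine ⟨fun a => (e a).1, fun a => h1 _ (e a).2, fun y => ?_⟩
    obtain ⟨n, hn⟩ := h2 y
    refine ⟨n, fun a b _ _ ha hb => e.injective (Subtype.ext (hn _ (e a).2 _ (e b).2 ha hb))⟩

/-- A closed set which is nowhere small and in which `⋃ m, F n m` has empty interior. -/
structure NiceS {T : Type u} [TopologicalSpace T] (k : Cardinal.{u}) (X : Set (ℕ → T))
    (F : ℕ → ℕ → Set (ℕ → T)) where
  Z : Set (ℕ → T)
  n : ℕ
  closed : IsClosed Z
  nonempty : Z.Nonempty
  big : ∀ U, IsOpen U → (U ∩ Z).Nonempty → ¬ SmallS k X (X ∩ Z ∩ U)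
  thin : ∀ U, IsOpen U → (U ∩ Z).Nonempty → ¬ (U ∩ Z ⊆ ⋃ m, F n m)

theorem NiceS.not_WLT {T : Type u} [TopologicalSpace T] {k : Cardinal.{u}} {X : Set (ℕ → T)}
    {F : ℕ → ℕ → Set (ℕ → T)} (N : NiceS k X F) :
    ∀ U, IsOpen U → (U ∩ N.Z).Nonempty → ¬ WLT k (N.Z ∩ U) := by
  intro U hU hne hw
  apply N.big U hU hne
  refine ⟨fun _ => X ∩ N.Z ∩ U, fun _ => ∅, fun _ x _ => ⟨univ, isOpen_univ, mem_univ _, ?_⟩,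
    fun _ => IsGδ.empty, fun _ => empty_subset _, fun x hx => mem_iUnion.2 ⟨0, Or.inl hx⟩⟩
  exact hw.mono fun z hz => ⟨hz.1.1.2, hz.1.2⟩

theorem exists_nice {T : Type u} [TopologicalSpace T] [DiscreteTopology T] {k : Cardinal.{u}}
    {X : Set (ℕ → T)} {F : ℕ → ℕ → Set (ℕ → T)} (hX : X = ⋂ n, ⋃ m, F n m)
    (hanti : ∀ n n', n ≤ n' → (⋃ m, F n' m) ⊆ ⋃ m, F n m)
    {C : Set (ℕ → T)} (hC : IsClosed C) (hbig : ¬ SmallS k X (X ∩ C)) (N : ℕ) :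
    ∃ M : NiceS k X F, M.Z ⊆ C ∧ N ≤ M.n := by
  by_contra hcon
  have hcon' : ∀ M : NiceS k X F, M.Z ⊆ C → M.n < N := fun M hM => by
    by_contra h
    exact hcon ⟨M, hM, not_lt.1 h⟩
  have key : ∀ n, N ≤ n → ∃ E, IsGδ E ∧ E ⊆ (⋃ m, F n m) ∧ SmallS k X ((X ∩ C) \ E) := by
    intro n hn
    let J : Set (ℕ → T) → Prop := fun A =>
      ∃ E, IsGδ E ∧ E ⊆ (⋃ m, F n m) ∧ SmallS k X ((X ∩ C ∩ A) \ E)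
    let 𝒪 : Set (Set (ℕ → T)) := {O | IsOpen O ∧ J O}
    have hOo : IsOpen (⋃₀ 𝒪) := isOpen_sUnion fun O hO => hO.1
    have hJO : J (⋃₀ 𝒪) := by
      obtain ⟨𝒞, ho, hd, hr, hcov⟩ := exists_disjoint_refinement 𝒪 fun O hO => hO.1
      have : ∀ D : 𝒞, J D.1 := by
        intro D
        obtain ⟨O, ⟨-, E, h1, h2, h3⟩, hDO⟩ := hr D.1 D.2
        exact ⟨E, h1, h2, h3.mono fun z hz => ⟨⟨hz.1.1, hDO hz.1.2⟩, hz.2⟩⟩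
      choose E h1 h2 h3 using this
      refine ⟨⋃ D : 𝒞, E D ∩ D.1, isGδ_disjoint_union 𝒞 ho hd E h1,
        iUnion_subset fun D => inter_subset_left.trans (h2 D), ?_⟩
      refine (SmallS.disjoint_union 𝒞 ho hd _ h3).mono ?_
      rintro z ⟨⟨hz, hzO⟩, hzE⟩
      obtain ⟨D, hD, hzD⟩ := hcov hzO
      refine mem_iUnion.2 ⟨⟨D, hD⟩, ⟨⟨hz, hzD⟩, fun h => hzE ?_⟩, hzD⟩
      exact mem_iUnion.2 ⟨⟨D, hD⟩, h, hzD⟩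
    obtain ⟨E, hE1, hE2, hE3⟩ := hJO
    rcases (C \ ⋃₀ 𝒪).eq_empty_or_nonempty with hemp | hne
    · refine ⟨E, hE1, hE2, hE3.mono ?_⟩
      rintro z ⟨hz, hzE⟩
      exact ⟨⟨hz, sdiff_eq_empty.1 hemp hz.2⟩, hzE⟩
    exfalso
    have hZc : IsClosed (C \ ⋃₀ 𝒪) := hC.sdiff hOo
    have hmax : ∀ U, IsOpen U → (U ∩ (C \ ⋃₀ 𝒪)).Nonempty → ¬ J (U ∪ ⋃₀ 𝒪) := by
      rintro U hU ⟨z, hzU, -, hzO⟩ hJ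
      exact hzO ⟨U ∪ ⋃₀ 𝒪, ⟨hU.union hOo, hJ⟩, Or.inl hzU⟩
    have := hcon' ⟨C \ ⋃₀ 𝒪, n, hZc, hne, ?_, ?_⟩ sdiff_subset
    · exact absurd hn (not_le.2 this)
    · intro U hU hUne hs
      refine hmax U hU hUne ⟨E, hE1, hE2, (hs.union hE3).mono ?_⟩
      rintro z ⟨⟨hz, hzUO⟩, hzE⟩
      by_cases hzO : z ∈ ⋃₀ 𝒪
      · exact Or.inr ⟨⟨hz, hzO⟩, hzE⟩
      · exact Or.inl ⟨⟨hz.1, hz.2, hzO⟩, hzUO.resolve_right hzO⟩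
    · intro U hU hUne hs
      refine hmax U hU hUne ⟨(E ∩ ⋃₀ 𝒪) ∪ (U ∩ (C \ ⋃₀ 𝒪)),
        (hE1.inter hOo.isGδ).union (hU.isGδ.inter ?_), ?_, hE3.mono ?_⟩
      · let _ := TopologicalSpace.metrizableSpaceMetric (ℕ → T)
        exact hZc.isGδ
      · exact union_subset (inter_subset_left.trans hE2) hs
      · rintro z ⟨⟨hz, hzUO⟩, hzE⟩
        by_cases hzO : z ∈ ⋃₀ 𝒪
        · exact ⟨⟨hz, hzO⟩, fun h => hzE (Or.inl ⟨h, hzO⟩)⟩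
        · exact absurd (Or.inr ⟨hzUO.resolve_right hzO, hz.2, hzO⟩) hzE
  have key' : ∀ n, ∃ E, IsGδ E ∧ E ⊆ (⋃ m, F (N + n) m) ∧ SmallS k X ((X ∩ C) \ E) :=
    fun n => key _ (Nat.le_add_right _ _)
  choose E h1 h2 h3 using key'
  apply hbig
  have hEX : (⋂ n, E n) ⊆ X := by
    rw [hX]
    refine subset_iInter fun n => ?_
    exact (iInter_subset E n).trans ((h2 n).trans (hanti _ _ (Nat.le_add_left _ _)))
  refine ((SmallS.iUnion h3).union (SmallS.of_isGδ (IsGδ.iInter h1) hEX)).mono ?_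
  intro z hz
  by_cases hzE : z ∈ ⋂ n, E n
  · exact Or.inr hzE
  · left
    simp only [mem_iInter, not_forall] at hzE
    obtain ⟨n, hn⟩ := hzE
    exact mem_iUnion.2 ⟨n, hz, hn⟩

theorem NiceS.exists_next {T : Type u} [TopologicalSpace T] [DiscreteTopology T]
    {k : Cardinal.{u}}
    {X : Set (ℕ → T)} {F : ℕ → ℕ → Set (ℕ → T)} (hF : ∀ n m, IsClosed (F n m))
    (hX : X = ⋂ n, ⋃ m, F n m)
    (hanti : ∀ n n', n ≤ n' → (⋃ m, F n' m) ⊆ ⋃ m, F n m)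
    (M : NiceS k X F) {U : Set (ℕ → T)} (hU : IsClopen U) (hne : (U ∩ M.Z).Nonempty) (N : ℕ) :
    ∃ M' : NiceS k X F, M'.Z ⊆ M.Z ∧ M'.Z ⊆ U ∧ M'.Z ⊆ (⋃ m, F M.n m) ∧ N ≤ M'.n := by
  have : ∃ m, ¬ SmallS k X (X ∩ (M.Z ∩ U ∩ F M.n m)) := by
    by_contra hcon
    push Not at hcon
    apply M.big U hU.2 hne
    refine (SmallS.iUnion hcon).mono ?_
    rintro z ⟨⟨hzX, hzZ⟩, hzU⟩
    have : z ∈ ⋃ m, F M.n m := by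
      rw [hX] at hzX
      exact mem_iInter.1 hzX _
    obtain ⟨m, hm⟩ := mem_iUnion.1 this
    exact mem_iUnion.2 ⟨m, hzX, ⟨hzZ, hzU⟩, hm⟩
  obtain ⟨m, hm⟩ := this
  obtain ⟨M', h1, h2⟩ := exists_nice hX hanti ((M.closed.inter hU.1).inter (hF M.n m)) hm N
  exact ⟨M', fun z hz => (h1 hz).1.1, fun z hz => (h1 hz).1.2,
    fun z hz => mem_iUnion.2 ⟨m, (h1 hz).2⟩, h2⟩

/-- A state of the construction. -/
structure StateS {T : Type u} [TopologicalSpace T] (k : Cardinal.{u}) (X : Set (ℕ → T))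
    (F : ℕ → ℕ → Set (ℕ → T)) where
  U : Set (ℕ → T)
  Zs : ℕ → NiceS k X F
  clopen : IsClopen U
  meets : ∀ j, (U ∩ (Zs j).Z).Nonempty
  sub : ∀ j, (Zs (j + 1)).Z ⊆ (Zs j).Z
  subF : ∀ j, (Zs (j + 1)).Z ⊆ ⋃ m, F (Zs j).n m
  le : ∀ j, j ≤ (Zs j).n

theorem StateS.anti {T : Type u} [TopologicalSpace T] {k : Cardinal.{u}} {X : Set (ℕ → T)}
    {F : ℕ → ℕ → Set (ℕ → T)} (S : StateS k X F) {i j : ℕ} (h : i ≤ j) :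
    (S.Zs j).Z ⊆ (S.Zs i).Z :=
  antitone_nat_of_succ_le (f := fun j => (S.Zs j).Z) S.sub h

/-- Extend a finite chain of nice sets inside a new clopen set. -/
theorem exists_restart {T : Type u} [TopologicalSpace T] [DiscreteTopology T]
    {k : Cardinal.{u}}
    {X : Set (ℕ → T)} {F : ℕ → ℕ → Set (ℕ → T)} (hF : ∀ n m, IsClosed (F n m))
    (hX : X = ⋂ n, ⋃ m, F n m)
    (hanti : ∀ n n', n ≤ n' → (⋃ m, F n' m) ⊆ ⋃ m, F n m)
    (Zs : ℕ → NiceS k X F) (c : ℕ)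
    (hsub : ∀ j < c, (Zs (j + 1)).Z ⊆ (Zs j).Z)
    (hsubF : ∀ j < c, (Zs (j + 1)).Z ⊆ ⋃ m, F (Zs j).n m)
    (hle : ∀ j ≤ c, j ≤ (Zs j).n)
    {U : Set (ℕ → T)} (hU : IsClopen U) (hne : (U ∩ (Zs c).Z).Nonempty) :
    ∃ S : StateS k X F, S.U = U ∧ ∀ j ≤ c, S.Zs j = Zs j := by
  have hnext : ∀ (M : {M : NiceS k X F // (U ∩ M.Z).Nonempty}) (N : ℕ),
      ∃ M' : {M : NiceS k X F // (U ∩ M.Z).Nonempty}, M'.1.Z ⊆ M.1.Z ∧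
        M'.1.Z ⊆ (⋃ m, F M.1.n m) ∧ N ≤ M'.1.n := by
    intro M N
    obtain ⟨M', h1, h2, h3, h4⟩ := NiceS.exists_next hF hX hanti M.1 hU M.2 N
    obtain ⟨z, hz⟩ := M'.nonempty
    exact ⟨⟨M', z, h2 hz, hz⟩, h1, h3, h4⟩
  choose nx hn1 hn2 hn3 using hnext
  let g : ℕ → {M : NiceS k X F // (U ∩ M.Z).Nonempty} := fun l =>
    Nat.rec ⟨Zs c, hne⟩ (fun l M => nx M (c + l + 1)) l
  have hg : ∀ l, g (l + 1) = nx (g l) (c + l + 1) := fun l => rfl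
  let Zs' : ℕ → NiceS k X F := fun j => if j ≤ c then Zs j else (g (j - c)).1
  have hlo : ∀ j ≤ c, Zs' j = Zs j := fun j hj => if_pos hj
  have hhi : ∀ l, Zs' (c + l) = (g l).1 := by
    intro l
    rcases Nat.eq_zero_or_pos l with rfl | hl
    · exact hlo _ le_rfl
    · have : ¬ (c + l ≤ c) := by omega
      simp only [Zs', if_neg this, Nat.add_sub_cancel_left]
  have hs1 : ∀ j, (Zs' (j + 1)).Z ⊆ (Zs' j).Z := by
    intro j
    rcases lt_or_ge j c with h | h
    · rw [hlo _ h, hlo _ h.le]; exact hsub j h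
    · obtain ⟨l, rfl⟩ := Nat.exists_eq_add_of_le h
      rw [hhi, add_assoc, hhi, hg]
      exact hn1 _ _
  refine ⟨⟨U, Zs', hU, ?_, hs1, ?_, ?_⟩, rfl, hlo⟩
  · intro j
    have hanti' : (Zs' (c + j)).Z ⊆ (Zs' j).Z :=
      antitone_nat_of_succ_le (f := fun j => (Zs' j).Z) hs1 (Nat.le_add_left _ _)
    have := (g j).2
    rw [← hhi] at this
    exact this.mono (inter_subset_inter_right _ hanti')
  · intro j
    rcases lt_or_ge j c with h | h
    · rw [hlo _ h, hlo _ h.le]; exact hsubF j h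
    · obtain ⟨l, rfl⟩ := Nat.exists_eq_add_of_le h
      rw [hhi, add_assoc, hhi, hg]
      exact hn2 _ _
  · intro j
    rcases le_or_gt j c with h | h
    · rw [hlo _ h]; exact hle j h
    · obtain ⟨l, rfl⟩ := Nat.exists_eq_add_of_lt h
      rw [add_assoc, hhi, hg]
      exact hn3 _ _

/-- One step of the construction. -/
theorem StateS.exists_step {T : Type u} [TopologicalSpace T] [DiscreteTopology T]
    {k : Cardinal.{u}} {o : T}
    (hT : (∀ a b : T, a ≠ o → b ≠ o → a = b) ∨ (Cardinal.aleph0 < k ∧ Cardinal.mk T ≤ k))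
    {X : Set (ℕ → T)} {F : ℕ → ℕ → Set (ℕ → T)} (hF : ∀ n m, IsClosed (F n m))
    (hX : X = ⋂ n, ⋃ m, F n m)
    (hanti : ∀ n n', n ≤ n' → (⋃ m, F n' m) ⊆ ⋃ m, F n m)
    (S : StateS k X F) (t i : ℕ) :
    ∃ S' : T → StateS k X F,
      (∀ a, (S' a).U ⊆ S.U ∧ ∃ y, (S' a).U ⊆ cylinder y (t + 1)) ∧
      (∀ y, ∃ n, ∀ a b, ((S' a).U ∩ cylinder y n).Nonempty →
        ((S' b).U ∩ cylinder y n).Nonempty → a = b) ∧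
      (∀ j ≤ t, (S' o).Zs j = S.Zs j) ∧
      (∀ a, a ≠ o → (∀ j ≤ i, (S' a).Zs j = S.Zs j) ∧
        ∀ m ≤ t, (S' a).U ∩ F (S.Zs i).n m = ∅) := by
  classical
  have hclop : ∀ (y : ℕ → T) n, IsClopen (cylinder y n) := fun y n =>
    ⟨isClosed_cyl y n, isOpen_cylinder (fun _ => T) y n⟩
  -- the bad closed set
  let K : Set (ℕ → T) := (⋃ m ∈ Finset.range (t + 1), F (S.Zs i).n m) ∪ (S.Zs (i + 1)).Z
  have hK : IsClosed K :=
    (isClosed_biUnion_finset fun m _ => hF _ m).union (S.Zs (i + 1)).closed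
  have hKF : K ⊆ ⋃ m, F (S.Zs i).n m := by
    refine union_subset ?_ (S.subF i)
    exact iUnion₂_subset fun m _ => subset_iUnion _ m
  obtain ⟨v, ⟨hvU, hvZ⟩, hvK⟩ : ∃ v, v ∈ S.U ∩ (S.Zs i).Z ∧ v ∉ K := by
    by_contra hcon
    push Not at hcon
    exact (S.Zs i).thin S.U S.clopen.2 (S.meets i) fun z hz => hKF (hcon z hz)
  obtain ⟨l, hl⟩ := exists_cyl_subset (S.clopen.2.inter hK.isOpen_compl) ⟨hvU, hvK⟩
  obtain ⟨z, hzU, hzZ⟩ := S.meets (max t (i + 1))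
  have hzV : z ∉ cylinder v l := fun h =>
    (hl h).2 (Or.inr (S.anti (le_max_right _ _) hzZ))
  obtain ⟨p, hp⟩ := exists_cyl_subset (S.clopen.2.inter (hclop v l).1.isOpen_compl) ⟨hzU, hzV⟩
  obtain ⟨D, hD1, hD2⟩ := exists_split_family hT (S.Zs i).not_WLT (hclop v l).2
    ⟨v, self_mem_cylinder _ _, hvZ⟩
  choose zs hzsD hzsZ using fun a => (hD1 a).2.2
  have ho : ∃ S' : StateS k X F, S'.U = cylinder z (max p (t + 1)) ∧
      ∀ j ≤ max t (i + 1), S'.Zs j = S.Zs j :=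
    exists_restart hF hX hanti S.Zs _ (fun j _ => S.sub j) (fun j _ => S.subF j)
      (fun j _ => S.le j) (hclop _ _) ⟨z, self_mem_cylinder _ _, hzZ⟩
  have ha : ∀ a, ∃ S' : StateS k X F, S'.U = D a ∩ cylinder (zs a) (t + 1) ∧
      ∀ j ≤ i, S'.Zs j = S.Zs j := fun a =>
    exists_restart hF hX hanti S.Zs _ (fun j _ => S.sub j) (fun j _ => S.subF j)
      (fun j _ => S.le j) ((hD1 a).1.inter (hclop _ _))
      ⟨zs a, ⟨hzsD a, self_mem_cylinder _ _⟩, hzsZ a⟩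
  obtain ⟨So, hSo1, hSo2⟩ := ho
  choose Sa hSa1 hSa2 using ha
  have hoU : So.U ⊆ cylinder z p := by rw [hSo1]; exact cylinder_anti _ (le_max_left _ _)
  have haU : ∀ a, (Sa a).U ⊆ cylinder v l := fun a => by
    rw [hSa1]; exact inter_subset_left.trans (hD1 a).2.1
  refine ⟨fun a => if a = o then So else Sa a, ?_, ?_, ?_, ?_⟩
  · intro a
    by_cases h : a = o
    · simp only [if_pos h]
      exact ⟨fun w hw => (hp (hoU hw)).1, z, by
        rw [hSo1]; exact cylinder_anti _ (le_max_right _ _)⟩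
    · simp only [if_neg h]
      exact ⟨fun w hw => (hl (haU a hw)).1, zs a, by rw [hSa1]; exact inter_subset_right⟩
  · intro y
    by_cases hy : y ∈ cylinder v l
    · obtain ⟨n, hn⟩ := hD2 y
      obtain ⟨q, hq⟩ := exists_cyl_subset (hclop v l).2 hy
      have hno : ∀ a, ((if a = o then So else Sa a).U ∩ cylinder y (max n q)).Nonempty →
          a ≠ o ∧ (D a ∩ cylinder y n).Nonempty := by
        rintro a ⟨w, hw1, hw2⟩
        have hane : a ≠ o := by
          rintro rfl
          rw [if_pos rfl] at hw1
          exact (hp (hoU hw1)).2 (hq (cylinder_anti _ (le_max_right _ _) hw2))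
        rw [if_neg hane, hSa1] at hw1
        exact ⟨hane, w, hw1.1, cylinder_anti _ (le_max_left _ _) hw2⟩
      refine ⟨max n q, fun a b h h' => ?_⟩
      obtain ⟨h1, h2⟩ := hno a h
      obtain ⟨h1', h2'⟩ := hno b h'
      exact hn a b h1 h1' h2 h2'
    · obtain ⟨q, hq⟩ := exists_cyl_subset (hclop v l).1.isOpen_compl hy
      have hno : ∀ a, ((if a = o then So else Sa a).U ∩ cylinder y q).Nonempty → a = o := by
        rintro a ⟨w, hw1, hw2⟩
        by_contra hane
        rw [if_neg hane] at hw1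
        exact hq hw2 (haU a hw1)
      exact ⟨q, fun a b h h' => (hno a h).trans (hno b h').symm⟩
  · intro j hj
    simp only [if_true]
    exact hSo2 j (hj.trans (le_max_left _ _))
  · intro a hane
    simp only [if_neg hane]
    refine ⟨hSa2 a, fun m hm => ?_⟩
    rw [eq_empty_iff_forall_notMem]
    rintro w ⟨hw, hwF⟩
    refine (hl (haU a hw)).2 (Or.inl ?_)
    exact mem_iUnion₂.2 ⟨m, Finset.mem_range.2 (by omega), hwF⟩

/-- The main construction: a closed embedding reducing the model set to `X`. -/
theorem exists_reduction {T : Type u} [TopologicalSpace T] [DiscreteTopology T]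
    {k : Cardinal.{u}} {o : T}
    (hT : (∀ a b : T, a ≠ o → b ≠ o → a = b) ∨ (Cardinal.aleph0 < k ∧ Cardinal.mk T ≤ k))
    {X : Set (ℕ → T)} {F : ℕ → ℕ → Set (ℕ → T)} (hF : ∀ n m, IsClosed (F n m))
    (hX : X = ⋂ n, ⋃ m, F n m)
    (hanti : ∀ n n', n ≤ n' → (⋃ m, F n' m) ⊆ ⋃ m, F n m)
    (hbig : ¬ SmallS k X X) :
    ∃ φ : (ℕ → T) → (ℕ → T), IsClosedEmbedding φ ∧
      ∀ x, φ x ∈ X ↔ ∀ i, ∀ᶠ t in atTop, (Nat.unpair t).1 = i → x t = o := by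
  obtain ⟨M0, -, -⟩ := exists_nice (k := k) hX hanti isClosed_univ (by rwa [inter_univ]) 0
  obtain ⟨S0, -, -⟩ := exists_restart hF hX hanti (fun _ => M0) 0 (by simp) (by simp) (by simp)
    isClopen_univ (by simpa using M0.nonempty)
  choose st hst1 hst2 hst3 hst4 using fun (S : StateS k X F) t i =>
    StateS.exists_step hT hF hX hanti S t i
  let run : (ℕ → T) → ℕ → StateS k X F := fun x t =>
    Nat.rec S0 (fun t S => st S t (Nat.unpair t).1 (x t)) t
  have hrun : ∀ x t, run x (t + 1) = st (run x t) t (Nat.unpair t).1 (x t) := fun x t => rfl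
  have hrun_congr : ∀ x x' t, (∀ s < t, x s = x' s) → run x t = run x' t := by
    intro x x' t
    induction t with
    | zero => intro _; rfl
    | succ t ih =>
      intro h
      rw [hrun, hrun, ih fun s hs => h s (by omega), h t (by omega)]
  have hUanti : ∀ x, Antitone fun t => (run x t).U := fun x =>
    antitone_nat_of_succ_le fun t => by rw [hrun]; exact (hst1 _ _ _ _).1
  choose pt hpt using fun S : StateS k X F => (S.meets 0)
  let φ : (ℕ → T) → (ℕ → T) := fun x i => pt (run x (i + 1)) i
  have hUcyl : ∀ x t, (run x t).U ⊆ cylinder (φ x) t := by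
    intro x t w hw i hi
    obtain ⟨y, hy⟩ := (hst1 (run x i) i (Nat.unpair i).1 (x i)).2
    rw [← hrun] at hy
    have h1 := hy (hUanti x (show i + 1 ≤ t from hi) hw) i (by omega)
    have h2 := hy (hpt (run x (i + 1))).1 i (by omega)
    rw [h1]; exact h2.symm
  have hmemcl : ∀ x (A : Set (ℕ → T)), IsClosed A → (∃ t0, ∀ t ≥ t0, ((run x t).U ∩ A).Nonempty) →
      φ x ∈ A := by
    rintro x A hA ⟨t0, h⟩
    by_contra hx
    obtain ⟨n, hn⟩ := exists_cyl_subset hA.isOpen_compl hx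
    obtain ⟨w, hw, hwA⟩ := h (max t0 n) (le_max_left _ _)
    exact hn (cylinder_anti _ (le_max_right _ _) (hUcyl x _ hw)) hwA
  have hφU : ∀ x t, φ x ∈ (run x t).U := by
    intro x t
    refine hmemcl x _ (run x t).clopen.1 ⟨t, fun s hs => ?_⟩
    have := (hpt (run x s)).1
    exact ⟨_, this, hUanti x hs this⟩
  have hcont : Continuous φ := by
    refine continuous_pi fun i => ?_
    refine IsLocallyConstant.continuous ?_
    rw [IsLocallyConstant.iff_eventually_eq]
    intro x
    filter_upwards [(isOpen_cylinder (fun _ => T) x (i + 1)).mem_nhds (self_mem_cylinder _ _)]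
      with x' hx'
    change pt (run x' (i + 1)) i = pt (run x (i + 1)) i
    rw [hrun_congr x' x (i + 1) hx']
  have hsep : ∀ y t, ∃ n, ∀ x x', φ x ∈ cylinder y n → φ x' ∈ cylinder y n →
      ∀ s < t, x s = x' s := by
    intro y t
    induction t with
    | zero => exact ⟨0, by simp⟩
    | succ t ih =>
      obtain ⟨n, hn⟩ := ih
      by_cases hx0 : ∃ x0, φ x0 ∈ cylinder y n
      · obtain ⟨x0, hx0⟩ := hx0
        obtain ⟨q, hq⟩ := hst2 (run x0 t) t (Nat.unpair t).1 y
        refine ⟨max n q, fun x x' hx hx' => ?_⟩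
        have h1 := cylinder_anti y (le_max_left n q) hx
        have h1' := cylinder_anti y (le_max_left n q) hx'
        have h2 := cylinder_anti y (le_max_right n q) hx
        have h2' := cylinder_anti y (le_max_right n q) hx'
        intro s hs
        rcases Nat.lt_succ_iff_lt_or_eq.1 hs with hs | rfl
        · exact hn x x' h1 h1' s hs
        · refine hq _ _ ⟨φ x, ?_, h2⟩ ⟨φ x', ?_, h2'⟩
          · rw [← hrun_congr x x0 s (hn x x0 h1 hx0), ← hrun]; exact hφU x (s + 1)
          · rw [← hrun_congr x' x0 s (hn x' x0 h1' hx0), ← hrun]; exact hφU x' (s + 1)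
      · exact ⟨n, fun x x' hx _ => (hx0 ⟨x, hx⟩).elim⟩
  have hind : IsInducing φ := by
    rw [isInducing_iff_nhds]
    intro x
    refine le_antisymm (hcont.tendsto x).le_comap ?_
    intro A hA
    obtain ⟨O, hOA, hO, hxO⟩ := mem_nhds_iff.1 hA
    obtain ⟨t, ht⟩ := exists_cyl_subset hO hxO
    obtain ⟨n, hn⟩ := hsep (φ x) t
    refine ⟨cylinder (φ x) n, (isOpen_cylinder (fun _ => T) _ _).mem_nhds (self_mem_cylinder _ _),
      fun x' hx' => hOA (ht ?_)⟩
    exact hn x' x hx' (self_mem_cylinder _ _)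
  have hclosed : IsClosed (range φ) := by
    refine isClosed_of_closure_subset fun y hy => ?_
    have : ∀ n, ∃ x, φ x ∈ cylinder y n := by
      intro n
      obtain ⟨_, h, x, rfl⟩ := mem_closure_iff.1 hy (cylinder y n)
        (isOpen_cylinder (fun _ => T) _ _) (self_mem_cylinder _ _)
      exact ⟨x, h⟩
    choose xs hxs using this
    choose q hq using hsep y
    let x : ℕ → T := fun t => xs (q (t + 1)) t
    refine ⟨x, ?_⟩
    have hlim : Tendsto xs atTop (𝓝 x) := by
      rw [tendsto_pi_nhds]
      intro t
      refine tendsto_const_nhds.congr' ?_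
      filter_upwards [eventually_ge_atTop (q (t + 1))] with n hn
      exact hq (t + 1) _ _ (hxs _) (cylinder_anti y hn (hxs n)) t (by omega)
    have hlim2 : Tendsto (fun n => φ (xs n)) atTop (𝓝 y) := by
      rw [tendsto_pi_nhds]
      intro t
      refine tendsto_const_nhds.congr' ?_
      filter_upwards [eventually_ge_atTop (t + 1)] with n hn
      exact (hxs n t (by omega)).symm
    exact tendsto_nhds_unique ((hcont.tendsto x).comp hlim) hlim2
  refine ⟨φ, ⟨⟨hind, hind.injective⟩, hclosed⟩, ?_⟩
  have hstab : ∀ x i, (∀ i' < i, ∀ᶠ t in atTop, (Nat.unpair t).1 = i' → x t = o) →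
      ∃ t0, ∀ t ≥ t0, (run x t).Zs i = (run x t0).Zs i := by
    intro x i h
    have h' : ∀ᶠ t in atTop, ∀ i' ∈ Finset.range i, (Nat.unpair t).1 = i' → x t = o := by
      rw [Filter.eventually_all_finset]
      exact fun i' hi' => h i' (Finset.mem_range.1 hi')
    obtain ⟨t0, ht0⟩ := eventually_atTop.1 (h'.and (eventually_ge_atTop i))
    refine ⟨t0, fun t ht => ?_⟩
    induction t, ht using Nat.le_induction with
    | base => rfl
    | succ t ht ih =>
      rw [hrun]
      by_cases hxt : x t = o
      · rw [hxt, hst3 _ _ _ _ (ht0 t ht).2, ih]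
      · rw [(hst4 (run x t) t (Nat.unpair t).1 (x t) hxt).1 i ?_, ih]
        by_contra hlt
        exact hxt ((ht0 t ht).1 _ (Finset.mem_range.2 (not_le.1 hlt)) rfl)
  intro x
  constructor
  · intro hxX
    by_contra hcon
    push Not at hcon
    classical
    have hex : ∃ i, ∃ᶠ t in atTop, (Nat.unpair t).1 = i ∧ x t ≠ o := hcon
    have hmin := fun i hi => Nat.find_min hex (m := i) hi
    have hfreq := Nat.find_spec hex
    set i := Nat.find hex with hi
    obtain ⟨t0, ht0⟩ := hstab x i (fun i' hi' => by
      have := hmin i' hi'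
      rw [not_frequently] at this
      exact this.mono fun t ht h1 => by
        by_contra h2
        exact ht ⟨h1, h2⟩)
    rw [hX] at hxX
    obtain ⟨m, hm⟩ := mem_iUnion.1 (mem_iInter.1 hxX ((run x t0).Zs i).n)
    obtain ⟨t, ht, hti, hxt⟩ := frequently_atTop.1 hfreq (max t0 m)
    have h1 := (hst4 (run x t) t (Nat.unpair t).1 (x t) hxt).2 m ((le_max_right _ _).trans ht)
    rw [← hrun, hti, ht0 t ((le_max_left _ _).trans ht)] at h1
    have : φ x ∈ (∅ : Set (ℕ → T)) := by
      rw [← h1]; exact ⟨hφU x (t + 1), hm⟩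
    exact this
  · intro h
    rw [hX]
    refine mem_iInter.2 fun j => ?_
    obtain ⟨t0, ht0⟩ := hstab x (j + 1) fun i _ => h i
    have hmem : φ x ∈ ((run x t0).Zs (j + 1)).Z := by
      refine hmemcl x _ (NiceS.closed _) ⟨t0, fun t ht => ?_⟩
      rw [← ht0 t ht]
      exact (run x t).meets _
    exact hanti _ _ ((run x t0).le j) ((run x t0).subF j hmem)


/-- Shift-like step used for the unary coding of sequences of naturals. -/
def stepN (n : ℕ → ℕ) : ℕ → ℕ := fun i =>
  if n 0 = 0 then n (i + 1) else if i = 0 then n 0 - 1 else n i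

/-- Unary coding of sequences of naturals by binary sequences. -/
def Ebit (n : ℕ → ℕ) : ℕ → Bool := fun p => decide ((stepN^[p] n) 0 ≠ 0)

lemma Ebit_step (n : ℕ → ℕ) (p : ℕ) : Ebit (stepN n) p = Ebit n (p + 1) := rfl

lemma Ebit_zero (n : ℕ → ℕ) : Ebit n 0 = decide (n 0 ≠ 0) := rfl

lemma continuous_stepN : Continuous stepN := by
  refine continuous_pi fun i => ?_
  have h : Continuous (fun n : ℕ → ℕ => (n 0, n (i + 1), n i)) := by fun_prop
  exact (continuous_of_discreteTopology
    (f := fun q : ℕ × ℕ × ℕ => if q.1 = 0 then q.2.1 else if i = 0 then q.1 - 1 else q.2.2)).comp h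

lemma continuous_Ebit : Continuous Ebit := by
  refine continuous_pi fun p => ?_
  have h : Continuous (fun n : ℕ → ℕ => (stepN^[p] n) 0) :=
    (continuous_apply 0).comp (continuous_stepN.iterate p)
  exact (continuous_of_discreteTopology (f := fun c : ℕ => decide (c ≠ 0))).comp h

lemma Ebit_determines (i : ℕ) : ∀ c (n : ℕ → ℕ), n 0 = c → ∃ N, ∀ n' : ℕ → ℕ,
    (∀ p < N, Ebit n' p = Ebit n p) → n' i = n i := by
  induction i with
  | zero =>
    intro c
    induction c with
    | zero =>
      intro n hn
      refine ⟨1, fun n' h => ?_⟩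
      have := h 0 (by omega)
      simp [Ebit_zero, hn] at this
      rw [this, hn]
    | succ c ih =>
      intro n hn
      obtain ⟨N, hN⟩ := ih (stepN n) (by simp [stepN, hn])
      refine ⟨N + 1, fun n' h => ?_⟩
      have h0 := h 0 (by omega)
      simp [Ebit_zero, hn] at h0
      have h1 := hN (stepN n') fun p hp => h (p + 1) (by omega)
      simp [stepN, hn, h0] at h1
      omega
  | succ i ihi =>
    intro c
    induction c with
    | zero =>
      intro n hn
      obtain ⟨N, hN⟩ := ihi _ (stepN n) rfl
      refine ⟨N + 1, fun n' h => ?_⟩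
      have h0 := h 0 (by omega)
      simp [Ebit_zero, hn] at h0
      have h1 := hN (stepN n') fun p hp => h (p + 1) (by omega)
      simpa [stepN, hn, h0] using h1
    | succ c ih =>
      intro n hn
      obtain ⟨N, hN⟩ := ih (stepN n) (by simp [stepN, hn])
      refine ⟨N + 1, fun n' h => ?_⟩
      have h0 := h 0 (by omega)
      simp [Ebit_zero, hn] at h0
      have h1 := hN (stepN n') fun p hp => h (p + 1) (by omega)
      simpa [stepN, hn, h0] using h1

lemma isEmbedding_Ebit : IsEmbedding Ebit := by
  have hind : IsInducing Ebit := by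
    rw [isInducing_iff_nhds]
    intro x
    refine le_antisymm (map_le_iff_le_comap.1 continuous_Ebit.continuousAt) ?_
    rw [nhds_pi (a := x), Filter.pi, le_iInf_iff]
    intro i
    rw [← tendsto_iff_comap, nhds_discrete ℕ, tendsto_pure]
    obtain ⟨N, hN⟩ := Ebit_determines i _ x rfl
    refine mem_comap.2 ⟨cylinder (Ebit x) N,
      (isOpen_cylinder (fun _ => Bool) _ N).mem_nhds (self_mem_cylinder _ _), fun n' h => ?_⟩
    exact hN n' fun p hp => h p hp
  exact hind.isEmbedding

lemma Ebit_ev : ∀ B c (x : ℕ → ℕ), x 0 = c → (∀ i ≥ B, x i = 0) →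
    ∃ M, ∀ p ≥ M, Ebit x p = false := by
  intro B
  induction B with
  | zero =>
    intro c x _ hx
    refine ⟨0, fun p _ => ?_⟩
    have hx0 : x = fun _ => 0 := funext fun i => hx i (by omega)
    have hs : stepN x = x := by subst hx0; rfl
    simp only [Ebit, Function.iterate_fixed hs]
    simp [hx0]
  | succ B ihB =>
    intro c
    induction c with
    | zero =>
      intro x hx0 hx
      obtain ⟨M, hM⟩ := ihB _ (stepN x) rfl fun i hi => by
        simp only [stepN, hx0, if_true]; exact hx _ (by omega)
      refine ⟨M + 1, fun p hp => ?_⟩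
      obtain ⟨p, rfl⟩ : ∃ q, p = q + 1 := ⟨p - 1, by omega⟩
      exact hM p (by omega)
    | succ c ih =>
      intro x hx0 hx
      obtain ⟨M, hM⟩ := ih (stepN x) (by simp [stepN, hx0]) fun i hi => by
        have : i ≠ 0 := by omega
        simp only [stepN, hx0, this]; simpa using hx _ hi
      refine ⟨M + 1, fun p hp => ?_⟩
      obtain ⟨p, rfl⟩ : ∃ q, p = q + 1 := ⟨p - 1, by omega⟩
      exact hM p (by omega)

lemma Ebit_surj : ∀ B (y : ℕ → Bool), (∀ p ≥ B, y p = false) →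
    ∃ x : ℕ → ℕ, (∃ M, ∀ i ≥ M, x i = 0) ∧ Ebit x = y := by
  intro B
  induction B with
  | zero =>
    intro y hy
    refine ⟨fun _ => 0, ⟨0, fun _ _ => rfl⟩, funext fun p => ?_⟩
    have hs : stepN (fun _ => 0) = (fun _ => 0) := rfl
    simp [Ebit, Function.iterate_fixed hs, hy p]
  | succ B ih =>
    intro y hy
    obtain ⟨x, ⟨M, hM⟩, hx⟩ := ih (fun p => y (p + 1)) fun p hp => hy _ (by omega)
    cases h0 : y 0 with
    | false =>
      refine ⟨fun i => if i = 0 then 0 else x (i - 1), ⟨M + 1, fun i hi => ?_⟩, funext fun p => ?_⟩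
      · have : i ≠ 0 := by omega
        simp only [this, if_false]; exact hM _ (by omega)
      · cases p with
        | zero => simp [Ebit_zero, h0]
        | succ p =>
          rw [← Ebit_step, ← congrFun hx p]
          congr 1
    | true =>
      refine ⟨fun i => if i = 0 then x 0 + 1 else x i, ⟨M + 1, fun i hi => ?_⟩, funext fun p => ?_⟩
      · have : i ≠ 0 := by omega
        simp only [this, if_false]; exact hM _ (by omega)
      · cases p with
        | zero => simp [Ebit_zero, h0]
        | succ p =>
          rw [← Ebit_step, ← congrFun hx p]
          congr 1
          funext i
          by_cases hi : i = 0
          · subst hi; simp [stepN]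
          · simp [stepN, hi]

lemma isHomeomorph_piMap {A B : Type*} [TopologicalSpace A] [DiscreteTopology A]
    [TopologicalSpace B] [DiscreteTopology B] (θ : A ≃ B) :
    IsEmbedding (fun (x : ℕ → A) n => θ (x n)) :=
  (Homeomorph.piCongrRight (fun _ : ℕ => θ.toHomeomorphOfDiscrete)).isEmbedding

lemma exists_e1 (k : Cardinal.{u}) (hk : Cardinal.aleph0 ≤ k) :
    ∃ (o : StarT k) (e : Qk k → (ℕ → StarT k)), IsEmbedding e ∧
      range e = {x | ∀ᶠ n in atTop, x n = o} ∧
      ((∀ a b : StarT k, a ≠ o → b ≠ o → a = b) ∨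
        (Cardinal.aleph0 < k ∧ Cardinal.mk (StarT k) ≤ k)) := by
  have hcard : Cardinal.mk (QBase k) = k := by
    have : Cardinal.mk (QBase k) = Cardinal.mk (DiscT k) + Cardinal.mk PUnit.{u + 1} := by
      simp [QBase]
    rw [this]
    simp only [DiscT, Cardinal.mk_out, Cardinal.mk_punit]
    exact Cardinal.add_one_eq hk
  have key : ∀ (o : StarT k) (E : (ℕ → QBase k) → (ℕ → StarT k)), IsEmbedding E →
      (∀ x : ℕ → QBase k, (∀ᶠ n in atTop, x n = Sum.inr PUnit.unit) →
        ∀ᶠ n in atTop, E x n = o) →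
      (∀ y : ℕ → StarT k, (∀ᶠ n in atTop, y n = o) → ∃ x : ℕ → QBase k,
        (∀ᶠ n in atTop, x n = Sum.inr PUnit.unit) ∧ E x = y) →
      ∃ (e : Qk k → (ℕ → StarT k)), IsEmbedding e ∧
      range e = {x | ∀ᶠ n in atTop, x n = o} := by
    intro o E hE h1 h2
    refine ⟨fun q => E q.1, hE.comp IsEmbedding.subtypeVal, ?_⟩
    ext y
    constructor
    · rintro ⟨q, rfl⟩; exact h1 _ q.2
    · intro hy
      obtain ⟨x, hx, rfl⟩ := h2 y hy
      exact ⟨⟨x, hx⟩, rfl⟩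
  by_cases hk0 : k = Cardinal.aleph0
  · have hS : StarT k = ULift Bool := by simp [StarT, hk0]
    let β : Bool ≃ StarT k := (Equiv.ulift.symm).trans (Equiv.cast hS.symm)
    have hc : Nonempty (QBase k ≃ ℕ) := by
      rw [← Cardinal.lift_mk_eq'.{u, 0}]
      rw [hcard, hk0]; simp
    obtain ⟨θ0⟩ := hc
    let θ : QBase k ≃ ℕ := θ0.trans (Equiv.swap (θ0 (Sum.inr PUnit.unit)) 0)
    have hθ : θ (Sum.inr PUnit.unit) = 0 := by
      change Equiv.swap (θ0 (Sum.inr PUnit.unit)) 0 (θ0 (Sum.inr PUnit.unit)) = 0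
      exact Equiv.swap_apply_left _ _
    have hθ' : ∀ a, θ a = 0 ↔ a = Sum.inr PUnit.unit := fun a => by
      rw [← hθ]; exact θ.injective.eq_iff
    obtain ⟨e, he, hr⟩ := key (β false) (fun x n => β (Ebit (fun n => θ (x n)) n))
      ((isHomeomorph_piMap β).comp (isEmbedding_Ebit.comp (isHomeomorph_piMap θ)))
      (by
        intro x hx
        obtain ⟨B, hB⟩ := eventually_atTop.1 hx
        obtain ⟨M, hM⟩ := Ebit_ev B _ (fun n => θ (x n)) rfl fun i hi => (hθ' _).2 (hB i hi)
        exact eventually_atTop.2 ⟨M, fun p hp => congrArg β (hM p hp)⟩)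
      (by
        intro y hy
        obtain ⟨B, hB⟩ := eventually_atTop.1 hy
        obtain ⟨x, ⟨M, hM⟩, hx⟩ := Ebit_surj B (fun p => β.symm (y p)) fun p hp => by
          simp [hB p hp]
        refine ⟨fun n => θ.symm (x n), eventually_atTop.2 ⟨M, fun i hi => ?_⟩, ?_⟩
        · rw [← hθ']; simp [hM i hi]
        · funext n
          simp [hx])
    refine ⟨β false, e, he, hr, Or.inl fun a b ha hb => ?_⟩
    have : ∀ a : StarT k, a ≠ β false → a = β true := by
      intro a ha
      obtain ⟨c, rfl⟩ := β.surjective a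
      cases c
      · exact (ha rfl).elim
      · rfl
    rw [this a ha, this b hb]
  · have hS : StarT k = DiscT k := by simp [StarT, hk0]
    have hcS : Cardinal.mk (StarT k) = k := by rw [hS]; simp [DiscT]
    obtain ⟨θ⟩ : Nonempty (QBase k ≃ StarT k) := by
      rw [← Cardinal.eq, hcard, hcS]
    obtain ⟨e, he, hr⟩ := key (θ (Sum.inr PUnit.unit)) (fun x n => θ (x n)) (isHomeomorph_piMap θ)
      (fun x hx => hx.mono fun n hn => congrArg θ hn)
      (fun y hy => ⟨fun n => θ.symm (y n), hy.mono fun n hn => by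
        exact (θ.symm_apply_eq).2 hn, by simp⟩)
    exact ⟨_, e, he, hr, Or.inr ⟨lt_of_le_of_ne hk (Ne.symm hk0), hcS.le⟩⟩

lemma exists_e (k : Cardinal.{u}) (hk : Cardinal.aleph0 ≤ k) :
    ∃ (o : StarT k) (e : QkOmega k → (ℕ → StarT k)), IsEmbedding e ∧
      range e = {x | ∀ i, ∀ᶠ t in atTop, (Nat.unpair t).1 = i → x t = o} ∧
      ((∀ a b : StarT k, a ≠ o → b ≠ o → a = b) ∨
        (Cardinal.aleph0 < k ∧ Cardinal.mk (StarT k) ≤ k)) := by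
  obtain ⟨o, e1, he1, hr1, hT⟩ := exists_e1 k hk
  let R : (ℕ → ℕ → StarT k) ≃ₜ (ℕ → StarT k) :=
    { toFun := fun y t => y (Nat.unpair t).1 (Nat.unpair t).2
      invFun := fun x i j => x (Nat.pair i j)
      left_inv := fun y => by funext i j; simp
      right_inv := fun x => by funext t; simp
      continuous_toFun := by fun_prop
      continuous_invFun := by fun_prop }
  have hpi : IsEmbedding (fun (q : ℕ → Qk k) i => e1 (q i)) := IsEmbedding.piMap fun _ => he1
  refine ⟨o, fun q => R (fun i => e1 (q i)), R.isEmbedding.comp hpi, ?_, hT⟩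
  ext x
  constructor
  · rintro ⟨q, rfl⟩ i
    have : e1 (q i) ∈ range e1 := mem_range_self _
    rw [hr1] at this
    obtain ⟨M, hM⟩ := eventually_atTop.1 this
    refine eventually_atTop.2 ⟨Nat.pair i M, fun t ht hti => ?_⟩
    change e1 (q (Nat.unpair t).1) (Nat.unpair t).2 = o
    rw [hti]
    apply hM
    by_contra hlt
    have h1 := Nat.pair_lt_pair_right i (not_le.1 hlt)
    rw [← hti, Nat.pair_unpair, hti] at h1
    omega
  · intro hx
    have : ∀ i, ∃ q : Qk k, e1 q = fun j => x (Nat.pair i j) := by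
      intro i
      have : (fun j => x (Nat.pair i j)) ∈ range e1 := by
        rw [hr1]
        obtain ⟨M, hM⟩ := eventually_atTop.1 (hx i)
        refine eventually_atTop.2 ⟨M, fun j hj => hM _ (hj.trans (Nat.right_le_pair i j)) ?_⟩
        simp
      exact this
    choose q hq using this
    refine ⟨q, ?_⟩
    simp only [hq]
    exact R.apply_symm_apply x

lemma exists_decreasing {Y : Type*} [TopologicalSpace Y] {X : Set Y} (hX : IsFsigmaDelta X) :
    ∃ F : ℕ → ℕ → Set Y, (∀ n m, IsClosed (F n m)) ∧ X = (⋂ n, ⋃ m, F n m) ∧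
      ∀ n n', n ≤ n' → (⋃ m, F n' m) ⊆ ⋃ m, F n m := by
  obtain ⟨G, hG, rfl⟩ := hX
  choose H hH hGH using hG
  let F : ℕ → ℕ → Set Y := fun n => Nat.rec (H 0)
    (fun n f m => f (Nat.unpair m).1 ∩ H (n + 1) (Nat.unpair m).2) n
  have hs : ∀ n m, F (n + 1) m = F n (Nat.unpair m).1 ∩ H (n + 1) (Nat.unpair m).2 :=
    fun _ _ => rfl
  have hU : ∀ n, (⋃ m, F (n + 1) m) = (⋃ m, F n m) ∩ G (n + 1) := by
    intro n
    ext y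
    simp only [hs, hGH, mem_iUnion, mem_inter_iff]
    constructor
    · rintro ⟨m, h1, h2⟩; exact ⟨⟨_, h1⟩, ⟨_, h2⟩⟩
    · rintro ⟨⟨a, h1⟩, ⟨b, h2⟩⟩
      exact ⟨Nat.pair a b, by simpa using ⟨h1, h2⟩⟩
  have hanti : Antitone fun n => ⋃ m, F n m :=
    antitone_nat_of_succ_le fun n => by rw [hU]; exact inter_subset_left
  refine ⟨F, ?_, ?_, fun n n' h => hanti h⟩
  · intro n
    induction n with
    | zero => exact hH 0
    | succ n ih => intro m; rw [hs]; exact (ih _).inter (hH _ _)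
  · refine Subset.antisymm (subset_iInter fun n => ?_) (subset_iInter fun n => ?_)
    · induction n with
      | zero => exact (iInter_subset _ 0).trans (hGH 0).subset
      | succ n ih => rw [hU]; exact subset_inter ih (iInter_subset _ _)
    · refine (iInter_subset _ n).trans ?_
      cases n with
      | zero => exact (hGH 0).symm.subset
      | succ n => rw [hU]; exact inter_subset_right

instance (k : Cardinal.{u}) : T2Space (Qk k) :=
  inferInstanceAs (T2Space {x : ℕ → QBase k // ∀ᶠ n in Filter.atTop, x n = Sum.inr PUnit.unit})

lemma exists_shift (k : Cardinal.{u}) (hk : Cardinal.aleph0 ≤ k) :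
    ∃ sh : (ℕ → Qk k) → (ℕ → Qk k), IsClosedEmbedding sh ∧
      ∀ q, ∃ p : ℕ → (ℕ → Qk k), Tendsto p atTop (𝓝 (sh q)) ∧ ∀ m, p m ∉ range sh := by
  have hne : Cardinal.mk (DiscT k) ≠ 0 := by
    simp only [DiscT, Cardinal.mk_out]
    exact (Cardinal.aleph0_pos.trans_le hk).ne'
  obtain ⟨a⟩ := Cardinal.mk_ne_zero_iff.1 hne
  let base : Qk k := ⟨fun _ => Sum.inr PUnit.unit, Eventually.of_forall fun _ => rfl⟩
  let δ : ℕ → Qk k := fun m => ⟨fun i => if i = m then Sum.inl a else Sum.inr PUnit.unit, by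
    filter_upwards [eventually_gt_atTop m] with i hi
    exact if_neg hi.ne'⟩
  have hδne : ∀ m, δ m ≠ base := by
    intro m h
    have h1 := congrFun (congrArg Subtype.val h) m
    simp only [δ, base, if_true] at h1
    cases h1
  have hδ : Tendsto δ atTop (𝓝 base) := by
    refine tendsto_subtype_rng.2 (tendsto_pi_nhds.2 fun i => ?_)
    refine tendsto_const_nhds.congr' ?_
    filter_upwards [eventually_gt_atTop i] with m hm
    exact (if_neg hm.ne).symm
  let sh : (ℕ → Qk k) → (ℕ → Qk k) := fun q i => Nat.casesOn i base q
  refine ⟨sh, ?_, fun q => ⟨fun m => Function.update (sh q) 0 (δ m), ?_, ?_⟩⟩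
  · refine Function.LeftInverse.isClosedEmbedding (f := fun p i => p (i + 1)) (fun q => rfl)
      (by fun_prop) ?_
    refine continuous_pi fun i => ?_
    cases i with
    | zero => exact continuous_const
    | succ i => exact continuous_apply i
  · have h1 : Tendsto (fun m => Function.update (sh q) 0 (δ m)) atTop
        (𝓝 (Function.update (sh q) 0 base)) := tendsto_const_nhds.update 0 hδ
    have h2 : Function.update (sh q) 0 base = sh q := Function.update_eq_self 0 (sh q)
    rwa [h2] at h1
  · rintro m ⟨q', h⟩
    apply hδne m
    have := congrFun h 0
    simpa [sh] using this.symm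

lemma main_aux (k : Cardinal.{u}) (hk : Cardinal.aleph0 ≤ k)
    (X : Set (ℕ → StarT k)) (hX : IsFsigmaDelta X)
    (hnot : ¬ SLWplusGDS ↥X k) :
    ∃ C : Set ↥X, IsClosed C ∧ IsNowhereDense C ∧ Nonempty (↥C ≃ₜ (ℕ → Qk k)) := by
  obtain ⟨o, e, he, hr, hT⟩ := exists_e k hk
  obtain ⟨F, hF, hXF, hanti⟩ := exists_decreasing hX
  obtain ⟨φ, hφ, hφX⟩ := exists_reduction hT hF hXF hanti fun h => hnot (SLWplusGDS_of_small h)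
  have hmem : ∀ q, φ (e q) ∈ X := fun q => by
    rw [hφX]
    have : e q ∈ range e := mem_range_self q
    rw [hr] at this
    exact this
  let g : (ℕ → Qk k) → ↥X := fun q => ⟨φ (e q), hmem q⟩
  have hg : IsClosedEmbedding g := by
    refine ⟨(hφ.isEmbedding.comp he).codRestrict X hmem, ?_⟩
    have : range g = Subtype.val ⁻¹' (range φ) := by
      ext ⟨x, hx⟩
      constructor
      · rintro ⟨q, h⟩; exact ⟨e q, congrArg Subtype.val h⟩
      · rintro ⟨y, rfl⟩
        have : y ∈ range e := by
          rw [hr]; exact (hφX y).1 hx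
        obtain ⟨q, rfl⟩ := this
        exact ⟨q, rfl⟩
    rw [this]
    exact hφ.isClosed_range.preimage continuous_subtype_val
  obtain ⟨sh, hsh, hp⟩ := exists_shift k hk
  have hc := hg.comp hsh
  refine ⟨range (g ∘ sh), hc.isClosed_range, ?_, ⟨hc.isEmbedding.toHomeomorph.symm⟩⟩
  rw [IsNowhereDense, hc.isClosed_range.closure_eq, eq_empty_iff_forall_notMem]
  intro x hx
  obtain ⟨q, rfl⟩ := interior_subset hx
  obtain ⟨p, hpt, hpn⟩ := hp q
  have h1 : Tendsto (fun m => g (p m)) atTop (𝓝 (g (sh q))) :=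
    (hg.continuous.tendsto _).comp hpt
  obtain ⟨m, hm⟩ := (h1.eventually (isOpen_interior.mem_nhds hx)).exists
  obtain ⟨q', hq'⟩ := interior_subset hm
  exact hpn m ⟨q', hg.injective hq'⟩

end Helpers

/-- Corollary `c-cm2`: such an `X` contains a nowhere dense closed copy
of `Q(k)^ω`. -/
theorem stmt_14 (k : Cardinal.{u}) (hk : Cardinal.aleph0 ≤ k)
    (X : Set (BaireStar k)) (hX : IsFsigmaDelta X)
    (hnot : ¬ SLWplusGDS ↥X k) :
    ∃ C : Set ↥X, IsClosed C ∧ IsNowhereDense C ∧ IsQkOmega k ↥C := by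
  exact main_aux k hk X hX hnot
end

section
/- Let k be an infinite cardinal and let X and Y be F_σδ-subsets of the space B*(k) such that X does not belong to σLW(<k) + 𝒢_δσ. Then there exists a nowhere dense closed subset F of X such that F is homeomorphic to Y. -/
open Topology Set Filter

universe u v

set_option linter.unusedSectionVars false
set_option linter.unusedVariables false

namespace HW

section basics

variable {T : Type u} [TopologicalSpace T] [DiscreteTopology T]

/-- The cylinder of the points agreeing with `x` below `n`. -/
def cyl (x : ℕ → T) (n : ℕ) : Set (ℕ → T) := {y | ∀ i < n, y i = x i}

lemma self_mem_cyl (x : ℕ → T) (n : ℕ) : x ∈ cyl x n := fun _ _ => rfl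

lemma cyl_eq {x y : ℕ → T} {n m : ℕ} (h : y ∈ cyl x n) (hm : m ≤ n) : cyl y m = cyl x m := by
  ext z
  constructor
  · intro hz i hi
    rw [hz i hi, h i (lt_of_lt_of_le hi hm)]
  · intro hz i hi
    rw [hz i hi, h i (lt_of_lt_of_le hi hm)]

lemma cyl_anti (x : ℕ → T) {m n : ℕ} (h : m ≤ n) : cyl x n ⊆ cyl x m :=
  fun _ hy i hi => hy i (lt_of_lt_of_le hi h)

lemma cyl_open (x : ℕ → T) (n : ℕ) : IsOpen (cyl x n) := by
  have : cyl x n = ⋂ i ∈ Finset.range n, (fun y : ℕ → T => y i) ⁻¹' {x i} := by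
    ext y; simp [cyl]
  rw [this]
  exact isOpen_biInter_finset fun i _ => (isOpen_discrete _).preimage (continuous_apply i)

lemma isOpen_iff_cyl {s : Set (ℕ → T)} : IsOpen s ↔ ∀ x ∈ s, ∃ n, cyl x n ⊆ s := by
  constructor
  · intro hs x hx
    rw [isOpen_pi_iff] at hs
    obtain ⟨I, u, hu, hsub⟩ := hs x hx
    refine ⟨I.sup id + 1, fun y hy => hsub ?_⟩
    intro i hi
    have : i < I.sup id + 1 := Nat.lt_succ_of_le (Finset.le_sup (f := id) hi)
    rw [hy i this]
    exact (hu i hi).2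
  · intro h
    rw [isOpen_iff_mem_nhds]
    intro x hx
    obtain ⟨n, hn⟩ := h x hx
    exact Filter.mem_of_superset ((cyl_open x n).mem_nhds (self_mem_cyl x n)) hn

lemma res_mem {x y : ℕ → T} {n : ℕ} : PiNat.res y n = PiNat.res x n ↔ y ∈ cyl x n := by
  rw [PiNat.res_eq_res]; rfl

lemma level_clopen (n : ℕ) (S : Set (List T)) : IsClopen {x : ℕ → T | PiNat.res x n ∈ S} := by
  have key : ∀ S : Set (List T), IsOpen {x : ℕ → T | PiNat.res x n ∈ S} := by
    intro S
    rw [isOpen_iff_cyl]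
    intro x hx
    refine ⟨n, fun y hy => ?_⟩
    have := res_mem.2 hy
    simp only [mem_ofPred_eq] at hx ⊢
    rwa [this]
  refine ⟨⟨?_⟩, key S⟩
  have := key Sᶜ
  convert this using 1
  ext x
  simp

lemma cyl_closed (x : ℕ → T) (n : ℕ) : IsClosed (cyl x n) := by
  have := (level_clopen (T := T) n {PiNat.res x n}).1
  convert this using 1
  ext y
  simp [res_mem]

lemma closed_mem_of_cyl {F : Set (ℕ → T)} (hF : IsClosed F) {x : ℕ → T}
    (h : ∀ n, (cyl x n ∩ F).Nonempty) : x ∈ F := by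
  by_contra hx
  obtain ⟨n, hn⟩ := isOpen_iff_cyl.1 hF.isOpen_compl x hx
  obtain ⟨y, hy, hyF⟩ := h n
  exact hn hy hyF

/-! ### Smallness -/

/-- The finite initial segments of points of `E`. -/
def pieces (E : Set (ℕ → T)) : Set (List T) := ⋃ n, (fun x => PiNat.res x n) '' E

/-- Combinatorial version of weight less than `k`. -/
def Few (k : Cardinal.{u}) (E : Set (ℕ → T)) : Prop := Cardinal.mk (pieces E) < k

lemma Few.mono {k : Cardinal.{u}} {E E' : Set (ℕ → T)} (h : Few k E) (hs : E' ⊆ E) : Few k E' :=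
  lt_of_le_of_lt (Cardinal.mk_le_mk_of_subset
    (iUnion_mono fun _ => image_mono hs)) h

/-- Locally few. -/
def LW (k : Cardinal.{u}) (L : Set (ℕ → T)) : Prop := ∀ x ∈ L, ∃ n, Few k (L ∩ cyl x n)

/-- Small sets, relative to `X`. -/
def Small (k : Cardinal.{u}) (X E : Set (ℕ → T)) : Prop :=
  ∃ L G : ℕ → Set (ℕ → T), (∀ n, LW k (L n)) ∧ (∀ n, IsGδ (G n) ∧ G n ⊆ X) ∧
    E ⊆ (⋃ n, L n) ∪ (⋃ n, G n)

variable {k : Cardinal.{u}} {X : Set (ℕ → T)}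

lemma Small.mono {E E' : Set (ℕ → T)} (h : Small k X E) (hs : E' ⊆ E) : Small k X E' := by
  obtain ⟨L, G, hL, hG, hE⟩ := h
  exact ⟨L, G, hL, hG, hs.trans hE⟩

lemma Small.iUnion {E : ℕ → Set (ℕ → T)} (h : ∀ n, Small k X (E n)) : Small k X (⋃ n, E n) := by
  choose L G hL hG hE using h
  refine ⟨fun n => L n.unpair.1 n.unpair.2, fun n => G n.unpair.1 n.unpair.2,
    fun n => hL _ _, fun n => hG _ _, ?_⟩
  intro x hx
  obtain ⟨n, hn⟩ := mem_iUnion.1 hx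
  rcases hE n hn with h | h
  · obtain ⟨m, hm⟩ := mem_iUnion.1 h
    left
    refine mem_iUnion.2 ⟨Nat.pair n m, ?_⟩
    simpa using hm
  · obtain ⟨m, hm⟩ := mem_iUnion.1 h
    right
    refine mem_iUnion.2 ⟨Nat.pair n m, ?_⟩
    simpa using hm

lemma Small.union {E E' : Set (ℕ → T)} (h : Small k X E) (h' : Small k X E') :
    Small k X (E ∪ E') := by
  have : Small k X (⋃ n : ℕ, if n = 0 then E else E') := by
    apply Small.iUnion
    intro n
    by_cases hn : n = 0
    · simpa [hn] using h
    · simpa [hn] using h'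
  refine this.mono ?_
  rintro x (hx | hx)
  · exact mem_iUnion.2 ⟨0, by simpa using hx⟩
  · exact mem_iUnion.2 ⟨1, by simpa using hx⟩

lemma LW_empty : LW k (∅ : Set (ℕ → T)) := fun x hx => hx.elim

lemma Few.lw {E : Set (ℕ → T)} (h : Few k E) : LW k E :=
  fun _ _ => ⟨0, h.mono inter_subset_left⟩

lemma Small.of_few {E : Set (ℕ → T)} (h : Few k E) : Small k X E :=
  ⟨fun _ => E, fun _ => ∅, fun _ => h.lw, fun _ => ⟨IsGδ.empty, empty_subset _⟩,
    fun _ hx => Or.inl (mem_iUnion.2 ⟨0, hx⟩)⟩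

lemma Small.of_gdelta {E : Set (ℕ → T)} (h : IsGδ E) (hE : E ⊆ X) : Small k X E :=
  ⟨fun _ => ∅, fun _ => E, fun _ => LW_empty, fun _ => ⟨h, hE⟩,
    fun _ hx => Or.inr (mem_iUnion.2 ⟨0, hx⟩)⟩

/-! ### Gluing along minimal cylinders -/

/-- The maximal cylinder around `x` with property `Q`. -/
def mc (Q : Set (ℕ → T) → Prop) (x : ℕ → T) : Set (ℕ → T) := cyl x (sInf {n | Q (cyl x n)})

/-- Union of the cylinders with property `Q`. -/
def UQ (Q : Set (ℕ → T) → Prop) : Set (ℕ → T) := {x | ∃ n, Q (cyl x n)}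

/-- Gluing of sets along the maximal cylinders. -/
def glue (Q : Set (ℕ → T) → Prop) (S : Set (ℕ → T) → Set (ℕ → T)) : Set (ℕ → T) :=
  {x | x ∈ UQ Q ∧ x ∈ S (mc Q x)}

variable {Q : Set (ℕ → T) → Prop}

lemma mc_prop {x : ℕ → T} (hx : x ∈ UQ Q) : Q (mc Q x) := Nat.sInf_mem (s := {n | Q (cyl x n)}) hx

lemma mc_eq {x y : ℕ → T} (hx : x ∈ UQ Q) (hy : y ∈ mc Q x) : y ∈ UQ Q ∧ mc Q y = mc Q x := by
  have h1 : Q (cyl y (sInf {n | Q (cyl x n)})) := by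
    rw [cyl_eq hy le_rfl]; exact mc_prop hx
  have hyU : y ∈ UQ Q := ⟨_, h1⟩
  refine ⟨hyU, ?_⟩
  have hle : sInf {n | Q (cyl y n)} ≤ sInf {n | Q (cyl x n)} := Nat.sInf_le h1
  have h2 : Q (cyl x (sInf {n | Q (cyl y n)})) := by
    rw [← cyl_eq hy hle]; exact mc_prop hyU
  have hle' : sInf {n | Q (cyl x n)} ≤ sInf {n | Q (cyl y n)} := Nat.sInf_le h2
  have : sInf {n | Q (cyl y n)} = sInf {n | Q (cyl x n)} := le_antisymm hle hle'
  unfold mc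
  rw [this, cyl_eq hy le_rfl]

lemma UQ_open : IsOpen (UQ Q) := by
  rw [isOpen_iff_cyl]
  rintro x ⟨n, hn⟩
  refine ⟨n, fun y hy => ⟨n, ?_⟩⟩
  rwa [cyl_eq hy le_rfl]

lemma glue_open {S : Set (ℕ → T) → Set (ℕ → T)} (hS : ∀ s, Q s → IsOpen (S s)) :
    IsOpen (glue Q S) := by
  rw [isOpen_iff_cyl]
  rintro x ⟨hx, hxS⟩
  obtain ⟨n, hn⟩ := isOpen_iff_cyl.1 (hS _ (mc_prop hx)) x hxS
  refine ⟨max n (sInf {n | Q (cyl x n)}), fun y hy => ?_⟩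
  have hy1 : y ∈ mc Q x := cyl_anti x (le_max_right _ _) hy
  obtain ⟨h1, h2⟩ := mc_eq hx hy1
  refine ⟨h1, ?_⟩
  rw [h2]
  exact hn (cyl_anti x (le_max_left _ _) hy)

lemma glue_gdelta {S : Set (ℕ → T) → Set (ℕ → T)} (hS : ∀ s, Q s → IsGδ (S s)) :
    IsGδ (glue Q S) := by
  have : ∀ s, ∃ O : ℕ → Set (ℕ → T), Q s → (∀ n, IsOpen (O n)) ∧ S s = ⋂ n, O n := by
    intro s
    by_cases hs : Q s
    · obtain ⟨O, h1, h2⟩ := isGδ_iff_eq_iInter_nat.1 (hS s hs)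
      exact ⟨O, fun _ => ⟨h1, h2⟩⟩
    · exact ⟨fun _ => ∅, fun h => (hs h).elim⟩
  choose O hO using this
  have heq : glue Q S = ⋂ n, glue Q (fun s => O s n) := by
    ext x
    simp only [mem_iInter]
    constructor
    · rintro ⟨hx, hxS⟩ n
      rw [(hO _ (mc_prop hx)).2] at hxS
      exact ⟨hx, mem_iInter.1 hxS n⟩
    · intro h
      refine ⟨(h 0).1, ?_⟩
      rw [(hO _ (mc_prop (h 0).1)).2]
      exact mem_iInter.2 fun n => (h n).2
  rw [heq]
  exact IsGδ.iInter_of_isOpen fun n => glue_open fun s hs => (hO s hs).1 n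

lemma glue_lw {S : Set (ℕ → T) → Set (ℕ → T)} (hS : ∀ s, Q s → LW k (S s)) :
    LW k (glue Q S) := by
  rintro x ⟨hx, hxS⟩
  obtain ⟨n, hn⟩ := hS _ (mc_prop hx) x hxS
  refine ⟨max n (sInf {n | Q (cyl x n)}), hn.mono ?_⟩
  rintro y ⟨⟨hyU, hyS⟩, hy⟩
  have hy1 : y ∈ mc Q x := cyl_anti x (le_max_right _ _) hy
  rw [(mc_eq hx hy1).2] at hyS
  exact ⟨hyS, cyl_anti x (le_max_left _ _) hy⟩

lemma small_glue {S : Set (ℕ → T) → Set (ℕ → T)} (hS : ∀ s, Q s → Small k X (S s)) :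
    Small k X (glue Q S) := by
  have : ∀ s, ∃ L G : ℕ → Set (ℕ → T), Q s → (∀ n, LW k (L n)) ∧ (∀ n, IsGδ (G n) ∧ G n ⊆ X) ∧
    S s ⊆ (⋃ n, L n) ∪ (⋃ n, G n) := by
    intro s
    by_cases hs : Q s
    · obtain ⟨L, G, h⟩ := hS s hs
      exact ⟨L, G, fun _ => h⟩
    · exact ⟨fun _ => ∅, fun _ => ∅, fun h => (hs h).elim⟩
  choose L G h using this
  refine ⟨fun n => glue Q (fun s => L s n), fun n => glue Q (fun s => G s n),
    fun n => glue_lw fun s hs => (h s hs).1 n,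
    fun n => ⟨glue_gdelta fun s hs => ((h s hs).2.1 n).1, ?_⟩, ?_⟩
  · rintro x ⟨hx, hxG⟩
    exact ((h _ (mc_prop hx)).2.1 n).2 hxG
  · rintro x ⟨hx, hxS⟩
    rcases (h _ (mc_prop hx)).2.2 hxS with h' | h'
    · obtain ⟨n, hn⟩ := mem_iUnion.1 h'
      exact Or.inl (mem_iUnion.2 ⟨n, hx, hn⟩)
    · obtain ⟨n, hn⟩ := mem_iUnion.1 h'
      exact Or.inr (mem_iUnion.2 ⟨n, hx, hn⟩)

/-! ### The extraction lemma -/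

variable (k X) in
/-- Auxiliary predicate. -/
def OK (A F s : Set (ℕ → T)) : Prop :=
  ∃ C, IsGδ C ∧ Disjoint C A ∧ Small k X ((X ∩ F ∩ s) \ C)

lemma core (A F : Set (ℕ → T)) (hF : IsClosed F) :
    (∃ K ⊆ F, IsClosed K ∧ K.Nonempty ∧ (∀ x ∈ K, ∀ n, ¬ Small k X (X ∩ K ∩ cyl x n)) ∧
      ∀ x ∈ K, ∀ n, (A ∩ K ∩ cyl x n).Nonempty) ∨
    ∃ C, IsGδ C ∧ Disjoint C A ∧ Small k X ((X ∩ F) \ C) := by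
  classical
  have : ∀ s, ∃ C, OK k X A F s → IsGδ C ∧ Disjoint C A ∧ Small k X ((X ∩ F ∩ s) \ C) := by
    intro s
    by_cases hs : OK k X A F s
    · obtain ⟨C, h⟩ := hs
      exact ⟨C, fun _ => h⟩
    · exact ⟨∅, fun h => (hs h).elim⟩
  choose C hC using this
  set U := UQ (OK k X A F) with hU
  set D := glue (OK k X A F) C with hD
  have hDg : IsGδ D := glue_gdelta fun s hs => (hC s hs).1
  have hDA : Disjoint D A := by
    rw [Set.disjoint_left]
    rintro x ⟨hx, hxC⟩ hxA
    exact Set.disjoint_left.1 (hC _ (mc_prop hx)).2.1 hxC hxA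
  have hDS : Small k X ((X ∩ F ∩ U) \ D) := by
    refine (small_glue (Q := OK k X A F) (S := fun s => (X ∩ F ∩ s) \ C s)
      fun s hs => (hC s hs).2.2).mono ?_
    rintro x ⟨⟨hxF, hxU⟩, hxD⟩
    refine ⟨hxU, ⟨hxF, self_mem_cyl x _⟩, fun h => hxD ⟨hxU, h⟩⟩
  by_cases hK : (F \ U).Nonempty
  · left
    refine ⟨F \ U, sdiff_subset, hF.sdiff UQ_open, hK, ?_, ?_⟩
    · rintro x ⟨hxF, hxU⟩ n hS
      apply hxU
      refine ⟨n, D, hDg, hDA, (hDS.union hS).mono ?_⟩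
      rintro y ⟨⟨⟨hyX, hyF⟩, hyc⟩, hyD⟩
      by_cases hyU : y ∈ U
      · exact Or.inl ⟨⟨⟨hyX, hyF⟩, hyU⟩, hyD⟩
      · exact Or.inr ⟨⟨hyX, hyF, hyU⟩, hyc⟩
    · rintro x ⟨hxF, hxU⟩ n
      by_contra hne
      rw [Set.not_nonempty_iff_eq_empty] at hne
      apply hxU
      have hcl : IsClosed ((F \ U) ∩ cyl x n) := (hF.sdiff UQ_open).inter (cyl_closed x n)
      refine ⟨n, D ∪ ((F \ U) ∩ cyl x n), hDg.union hcl.isGδ, ?_, hDS.mono ?_⟩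
      · rw [Set.disjoint_left]
        rintro y (hy | hy) hyA
        · exact Set.disjoint_left.1 hDA hy hyA
        · have : y ∈ A ∩ (F \ U) ∩ cyl x n := ⟨⟨hyA, hy.1⟩, hy.2⟩
          rw [hne] at this
          exact this
      · rintro y ⟨⟨⟨hyX, hyF⟩, hyc⟩, hyD⟩
        rw [mem_union, not_or] at hyD
        refine ⟨⟨⟨hyX, hyF⟩, ?_⟩, hyD.1⟩
        by_contra hyU
        exact hyD.2 ⟨⟨hyF, hyU⟩, hyc⟩
  · right
    refine ⟨D, hDg, hDA, hDS.mono ?_⟩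
    rintro y ⟨⟨hyX, hyF⟩, hyD⟩
    refine ⟨⟨⟨hyX, hyF⟩, ?_⟩, hyD⟩
    by_contra hyU
    exact hK ⟨y, hyF, hyU⟩

/-- Good closed sets for the construction. -/
structure Good (k : Cardinal.{u}) (X K : Set (ℕ → T)) : Prop where
  closed : IsClosed K
  ns : ∀ x ∈ K, ∀ n, ¬ Small k X (X ∩ K ∩ cyl x n)
  dense : ∃ O : ℕ → Set (ℕ → T), (∀ n, IsOpen (O n)) ∧ Antitone O ∧ Disjoint (⋂ n, O n) X ∧
    ∀ x ∈ K, ∀ n, ((⋂ n, O n) ∩ K ∩ cyl x n).Nonempty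

lemma extract_good {E : ℕ → ℕ → Set (ℕ → T)} (hE : ∀ n m, IsClosed (E n m))
    (hX : X = ⋂ n, ⋃ m, E n m) {F : Set (ℕ → T)} (hF : IsClosed F) (hns : ¬ Small k X (X ∩ F)) :
    ∃ K ⊆ F, K.Nonempty ∧ Good k X K := by
  by_contra hcon
  apply hns
  have key : ∀ j, ∃ C, IsGδ C ∧ Disjoint C (⋃ m, E j m)ᶜ ∧ Small k X ((X ∩ F) \ C) := by
    intro j
    rcases core (k := k) (X := X) (⋃ m, E j m)ᶜ F hF with ⟨K, hKF, hKc, hKn, h1, h2⟩ | h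
    · exfalso
      apply hcon
      refine ⟨K, hKF, hKn, hKc, h1, fun n => ⋂ m ∈ Finset.range n, (E j m)ᶜ, ?_, ?_, ?_, ?_⟩
      · intro n
        exact isOpen_biInter_finset fun m _ => (hE j m).isOpen_compl
      · intro a b hab x hx
        simp only [mem_iInter, Finset.mem_range] at hx ⊢
        intro i hi
        exact hx i (lt_of_lt_of_le hi hab)
      · rw [Set.disjoint_left]
        intro x hx hxX
        rw [hX] at hxX
        obtain ⟨m, hm⟩ := mem_iUnion.1 (mem_iInter.1 hxX j)
        simp only [mem_iInter, Finset.mem_range] at hx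
        exact hx (m + 1) m (Nat.lt_succ_self m) hm
      · intro x hx n
        obtain ⟨y, ⟨hyA, hyK⟩, hyc⟩ := h2 x hx n
        refine ⟨y, ⟨?_, hyK⟩, hyc⟩
        simp only [mem_iInter, Finset.mem_range]
        intro _ i _ hi
        exact hyA (mem_iUnion.2 ⟨i, hi⟩)
    · exact h
  choose C hCg hCd hCs using key
  refine ((Small.of_gdelta (k := k) (X := X) (IsGδ.iInter hCg) ?_).union
    (Small.iUnion hCs)).mono ?_
  · intro x hx
    rw [hX]
    refine mem_iInter.2 fun j => ?_
    by_contra hxj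
    exact Set.disjoint_left.1 (hCd j) (mem_iInter.1 hx j) hxj
  · intro x hx
    by_cases hxC : x ∈ ⋂ j, C j
    · exact Or.inl hxC
    · right
      simp only [mem_iInter, not_forall] at hxC
      obtain ⟨j, hj⟩ := hxC
      exact mem_iUnion.2 ⟨j, hx, hj⟩

lemma extract_level {E : ℕ → ℕ → Set (ℕ → T)} (hE : ∀ n m, IsClosed (E n m))
    (hX : X = ⋂ n, ⋃ m, E n m) {F : Set (ℕ → T)} (hF : IsClosed F) (hns : ¬ Small k X (X ∩ F))
    (n : ℕ) : ∃ K ⊆ F, IsClosed K ∧ ¬ Small k X (X ∩ K) ∧ ∀ i < n, K ⊆ ⋃ m, E i m := by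
  induction n with
  | zero => exact ⟨F, subset_rfl, hF, hns, fun i hi => (Nat.not_lt_zero i hi).elim⟩
  | succ n ih =>
    obtain ⟨K, hKF, hKc, hKs, hK⟩ := ih
    have : ∃ m, ¬ Small k X (X ∩ (K ∩ E n m)) := by
      by_contra hcon
      push Not at hcon
      refine hKs ((Small.iUnion hcon).mono ?_)
      rintro x ⟨hxX, hxK⟩
      have hx' := hxX
      rw [hX] at hx'
      obtain ⟨m, hm⟩ := mem_iUnion.1 (mem_iInter.1 hx' n)
      exact mem_iUnion.2 ⟨m, hxX, hxK, hm⟩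
    obtain ⟨m, hm⟩ := this
    refine ⟨K ∩ E n m, inter_subset_left.trans hKF, hKc.inter (hE n m), hm, ?_⟩
    intro i hi
    rcases Nat.lt_succ_iff_lt_or_eq.1 hi with h | h
    · exact inter_subset_left.trans (hK i h)
    · subst h
      exact fun x hx => mem_iUnion.2 ⟨m, hx.2⟩

lemma extract {E : ℕ → ℕ → Set (ℕ → T)} (hE : ∀ n m, IsClosed (E n m))
    (hX : X = ⋂ n, ⋃ m, E n m) {F : Set (ℕ → T)} (hF : IsClosed F) (hns : ¬ Small k X (X ∩ F))
    (n : ℕ) : ∃ K ⊆ F, K.Nonempty ∧ Good k X K ∧ ∀ i < n, K ⊆ ⋃ m, E i m := by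
  obtain ⟨K, h1, h2, h3, h4⟩ := extract_level hE hX hF hns n
  obtain ⟨K', h5, h6, h7⟩ := extract_good hE hX h2 h3
  exact ⟨K', h5.trans h1, h6, h7, fun i hi => h5.trans (h4 i hi)⟩

/-! ### Splitting -/

lemma closed_refine {ι : Type*} {W V : ι → Set (ℕ → T)} (hWo : ∀ i, IsOpen (W i))
    (hWd : ∀ i j, (W i ∩ W j).Nonempty → i = j) (hW : IsClosed (⋃ i, W i))
    (hV : ∀ i, IsClosed (V i)) (hVW : ∀ i, V i ⊆ W i) : IsClosed (⋃ i, V i) := by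
  rw [← isOpen_compl_iff, isOpen_iff_mem_nhds]
  intro x hx
  by_cases hxW : x ∈ ⋃ i, W i
  · obtain ⟨i, hi⟩ := mem_iUnion.1 hxW
    have hxV : x ∈ (V i)ᶜ := fun h => hx (mem_iUnion.2 ⟨i, h⟩)
    filter_upwards [(hWo i).mem_nhds hi, (hV i).isOpen_compl.mem_nhds hxV] with y hy1 hy2 hy3
    obtain ⟨j, hj⟩ := mem_iUnion.1 hy3
    have := hWd i j ⟨y, hy1, hVW j hj⟩
    subst this
    exact hy2 hj
  · filter_upwards [hW.isOpen_compl.mem_nhds hxW] with y hy1 hy3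
    obtain ⟨j, hj⟩ := mem_iUnion.1 hy3
    exact hy1 (mem_iUnion.2 ⟨j, hVW j hj⟩)

/-- A splitting of `V` along `K` indexed by `ι`. -/
structure Splits {ι : Type*} (V K : Set (ℕ → T)) (W : ι → Set (ℕ → T)) : Prop where
  clopen : ∀ i, IsClopen (W i)
  sub : ∀ i, W i ⊆ V
  disj : ∀ i j, (W i ∩ W j).Nonempty → i = j
  meets : ∀ i, (W i ∩ K).Nonempty
  closed : IsClosed (⋃ i, W i)

lemma Splits.comp {ι κ : Type*} {V K : Set (ℕ → T)} {W : ι → Set (ℕ → T)} (h : Splits V K W)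
    (e : κ ↪ ι) : Splits V K (fun i => W (e i)) where
  clopen i := h.clopen _
  sub i := h.sub _
  disj i j hij := e.injective (h.disj _ _ hij)
  meets i := h.meets _
  closed := by
    classical
    have : (⋃ i, W (e i)) = ⋃ j, if j ∈ Set.range e then W j else ∅ := by
      ext x
      simp only [mem_iUnion]
      constructor
      · rintro ⟨i, hi⟩
        exact ⟨e i, by simpa using hi⟩
      · rintro ⟨j, hj⟩
        split_ifs at hj with hjr
        · obtain ⟨i, rfl⟩ := hjr
          exact ⟨i, hj⟩
        · exact hj.elim
    rw [this]
    refine closed_refine (W := W) (fun i => (h.clopen i).isOpen) h.disj h.closed ?_ ?_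
    · intro j
      split_ifs
      · exact (h.clopen j).isClosed
      · exact isClosed_empty
    · intro j
      split_ifs
      · exact subset_rfl
      · exact empty_subset _

/-- Initial segments of length `n` of points of `E`. -/
def lev (n : ℕ) (E : Set (ℕ → T)) : Set (List T) := (fun x => PiNat.res x n) '' E

lemma pieces_le (E : Set (ℕ → T)) :
    Cardinal.mk (pieces E) ≤ Cardinal.sum fun n => Cardinal.mk (lev n E) := by
  have := Cardinal.mk_iUnion_le_sum_mk_lift (f := fun n => lev n E)
  rwa [Cardinal.lift_uzero] at this

lemma split_level {V K : Set (ℕ → T)} (hV : IsClopen V) (n : ℕ) :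
    Splits V K (fun l : lev n (V ∩ K) => V ∩ {x | PiNat.res x n ∈ ({l.1} : Set (List T))}) where
  clopen l := hV.inter (level_clopen n _)
  sub l := inter_subset_left
  disj := by
    rintro ⟨l, hl⟩ ⟨l', hl'⟩ ⟨x, ⟨_, hx⟩, ⟨_, hx'⟩⟩
    have h1 : PiNat.res x n = l := hx
    have h2 : PiNat.res x n = l' := hx'
    exact Subtype.ext (h1.symm.trans h2)
  meets := by
    rintro ⟨l, x, ⟨hxV, hxK⟩, rfl⟩
    exact ⟨x, ⟨hxV, rfl⟩, hxK⟩
  closed := by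
    have : (⋃ l : lev n (V ∩ K), V ∩ {x | PiNat.res x n ∈ ({l.1} : Set (List T))})
        = V ∩ {x | PiNat.res x n ∈ lev n (V ∩ K)} := by
      ext x
      simp only [mem_iUnion]
      constructor
      · rintro ⟨⟨l, hl⟩, hxV, hx⟩
        have h1 : PiNat.res x n = l := hx
        refine ⟨hxV, ?_⟩
        change PiNat.res x n ∈ lev n (V ∩ K)
        rw [h1]; exact hl
      · rintro ⟨hxV, hx⟩
        exact ⟨⟨PiNat.res x n, hx⟩, hxV, rfl⟩
    rw [this]
    exact (hV.inter (level_clopen n _)).isClosed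

lemma Splits.sigma {ι : Type*} {κ : ι → Type*} {V K : Set (ℕ → T)} {W : ι → Set (ℕ → T)}
    (h : Splits V K W) {W' : ∀ i, κ i → Set (ℕ → T)} (h' : ∀ i, Splits (W i) K (W' i)) :
    Splits V K (fun p : Σ i, κ i => W' p.1 p.2) where
  clopen p := (h' p.1).clopen _
  sub p := ((h' p.1).sub _).trans (h.sub _)
  disj := by
    rintro ⟨i, a⟩ ⟨j, b⟩ ⟨x, hx, hx'⟩
    have : i = j := h.disj i j ⟨x, (h' i).sub _ hx, (h' j).sub _ hx'⟩
    subst this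
    have : a = b := (h' i).disj _ _ ⟨x, hx, hx'⟩
    subst this
    rfl
  meets p := (h' p.1).meets _
  closed := by
    rw [iUnion_sigma]
    exact closed_refine (fun i => (h.clopen i).isOpen) h.disj h.closed
      (fun i => (h' i).closed) (fun i => iUnion_subset fun j => (h' i).sub j)

lemma split_big (hk : Cardinal.aleph0 < k) {K : Set (ℕ → T)}
    (hK : ∀ V : Set (ℕ → T), IsClopen V → (V ∩ K).Nonempty → ¬ Few k (V ∩ K))
    {V : Set (ℕ → T)} (hV : IsClopen V) (hne : (V ∩ K).Nonempty) :
    ∃ (ι : Type u) (W : ι → Set (ℕ → T)), k ≤ Cardinal.mk ι ∧ Splits V K W := by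
  by_cases hA : ∃ n, k ≤ Cardinal.mk (lev n (V ∩ K))
  · obtain ⟨n, hn⟩ := hA
    exact ⟨_, _, hn, split_level hV n⟩
  push Not at hA
  have hinf : ∃ n, (lev n (V ∩ K)).Infinite := by
    by_contra hcon
    push Not at hcon
    apply hK V hV hne
    have : (pieces (V ∩ K)).Countable := countable_iUnion fun n => (hcon n).countable
    exact lt_of_le_of_lt (Cardinal.le_aleph0_iff_set_countable.2 this) hk
  obtain ⟨n, hn⟩ := hinf
  let e := hn.natEmbedding
  have S0 := (split_level (K := K) hV n).comp e
  set W : ℕ → Set (ℕ → T) :=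
    fun i => V ∩ {x | PiNat.res x n ∈ ({(e i).1} : Set (List T))} with hW
  have key : ∀ m, ∃ j, Cardinal.mk (lev m (V ∩ K)) ≤ Cardinal.mk (lev j (W m ∩ K)) := by
    intro m
    by_contra hcon
    push Not at hcon
    apply hK (W m) (S0.clopen m) (S0.meets m)
    calc Cardinal.mk (pieces (W m ∩ K))
        ≤ Cardinal.lift.{u} (Cardinal.mk ℕ) * Cardinal.mk (lev m (V ∩ K)) := by
          refine (pieces_le _).trans ?_
          refine (Cardinal.sum_le_sum _ (fun _ => Cardinal.mk (lev m (V ∩ K)))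
            fun j => (hcon j).le).trans ?_
          simp
      _ < k := Cardinal.mul_lt_of_lt hk.le (by simpa using hk) (hA m)
  choose j hj using key
  refine ⟨_, _, ?_, S0.sigma (fun m => split_level (S0.clopen m) (j m))⟩
  rw [Cardinal.mk_sigma]
  have h1 : k ≤ Cardinal.mk (pieces (V ∩ K)) := not_lt.1 (hK V hV hne)
  exact h1.trans ((pieces_le _).trans (Cardinal.sum_le_sum _ _ hj))

lemma Good.ns' {K : Set (ℕ → T)} (h : Good k X K) {V : Set (ℕ → T)} (hV : IsOpen V)
    (hne : (V ∩ K).Nonempty) : ¬ Small k X (X ∩ (V ∩ K)) := by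
  obtain ⟨x, hxV, hxK⟩ := hne
  obtain ⟨n, hn⟩ := isOpen_iff_cyl.1 hV x hxV
  intro hs
  exact h.ns x hxK n (hs.mono fun y hy => ⟨hy.1.1, hn hy.2, hy.1.2⟩)

lemma split (hT : Nonempty (T ≃ Bool) ∨ Cardinal.aleph0 < k ∧ Cardinal.mk T ≤ k)
    {K : Set (ℕ → T)} (hK : Good k X K) {V : Set (ℕ → T)} (hV : IsClopen V)
    (hne : (V ∩ K).Nonempty) : ∃ W : T → Set (ℕ → T), Splits V K W := by
  rcases hT with ⟨⟨e⟩⟩ | ⟨hk, hT⟩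
  · have hns := hK.ns' hV.isOpen hne
    have h2 : ∃ x ∈ V ∩ K, ∃ y ∈ V ∩ K, x ≠ y := by
      by_contra hcon
      push Not at hcon
      apply hns
      by_cases hemp : (X ∩ (V ∩ K)).Nonempty
      · obtain ⟨x, hx⟩ := hemp
        have : X ∩ (V ∩ K) = {x} := by
          ext y
          constructor
          · intro hy
            exact hcon y hy.2 x hx.2
          · rintro rfl
            exact hx
        rw [this]
        refine Small.of_gdelta (IsGδ.singleton x) ?_
        rintro y rfl
        exact hx.1
      · rw [Set.not_nonempty_iff_eq_empty] at hemp
        rw [hemp]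
        exact Small.of_gdelta IsGδ.empty (empty_subset _)
    obtain ⟨x, hx, y, hy, hxy⟩ := h2
    obtain ⟨n, hn⟩ := Function.ne_iff.1 hxy
    have S0 := split_level (K := K) hV (n + 1)
    have hinj : Function.Injective (fun t : T => if e t then
        (⟨PiNat.res x (n + 1), x, hx, rfl⟩ : lev (n + 1) (V ∩ K)) else
        ⟨PiNat.res y (n + 1), y, hy, rfl⟩) := by
      have hd : PiNat.res x (n + 1) ≠ PiNat.res y (n + 1) := by
        intro h
        rw [PiNat.res_eq_res] at h
        exact hn (h (Nat.lt_succ_self n))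
      intro s t hst
      apply e.injective
      cases hs : e s <;> cases ht : e t <;> simp only [hs, ht] at hst ⊢
      · exact absurd (congrArg Subtype.val hst).symm (by simpa using hd)
      · exact absurd (congrArg Subtype.val hst) (by simpa using hd)
    exact ⟨_, S0.comp ⟨_, hinj⟩⟩
  · obtain ⟨ι, W, hι, hW⟩ := split_big (k := k) hk (K := K) (fun V hV hne hf =>
      hK.ns' hV.isOpen hne ((Small.of_few hf).mono inter_subset_right)) hV hne
    obtain ⟨e⟩ := Cardinal.le_def T ι |>.1 (hT.trans hι)
    exact ⟨_, hW.comp e⟩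

/-! ### Coding `F_σδ` sets -/

lemma coding {E : ℕ → ℕ → Set (ℕ → T)} (hE : ∀ n m, IsClosed (E n m)) {Y : Set (ℕ → T)}
    (hY : Y = ⋂ n, ⋃ m, E n m) : ∃ φ : List T → ℕ, (∀ a l, φ (a :: l) ≤ l.length) ∧
      ∀ x, x ∈ Y ↔ Tendsto (fun n => φ (PiNat.res x (n + 1))) atTop atTop := by
  classical
  let μ : ℕ → List T → ℕ := fun i l =>
    sInf {m | m = l.length ∨ ∃ y ∈ E i m, PiNat.res y l.length = l}
  have hμmem : ∀ i l, μ i l = l.length ∨ ∃ y ∈ E i (μ i l), PiNat.res y l.length = l := by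
    intro i l
    exact Nat.sInf_mem (s := {m | m = l.length ∨ ∃ y ∈ E i m, PiNat.res y l.length = l})
      ⟨l.length, Or.inl rfl⟩
  let φ : List T → ℕ := fun l =>
    sInf {i | i = l.tail.length ∨ μ i l ≠ μ i l.tail}
  have hφmem : ∀ l, φ l = l.tail.length ∨ μ (φ l) l ≠ μ (φ l) l.tail := by
    intro l
    exact Nat.sInf_mem (s := {i | i = l.tail.length ∨ μ i l ≠ μ i l.tail}) ⟨_, Or.inl rfl⟩
  refine ⟨φ, fun a l => Nat.sInf_le (Or.inl rfl), fun x => ?_⟩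
  -- monotonicity
  have hmono : ∀ i, Monotone (fun n => μ i (PiNat.res x n)) := by
    intro i
    refine monotone_nat_of_le_succ fun n => ?_
    by_contra hlt
    push Not at hlt
    have hle : μ i (PiNat.res x n) ≤ n := Nat.sInf_le (Or.inl (PiNat.res_length x n).symm)
    rcases hμmem i (PiNat.res x (n + 1)) with h | ⟨y, hyE, hy⟩
    · rw [PiNat.res_length] at h
      omega
    · refine absurd (Nat.sInf_le (m := μ i (PiNat.res x (n + 1))) (Or.inr ⟨y, hyE, ?_⟩))
        (not_le.2 hlt)
      rw [PiNat.res_length] at hy ⊢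
      rw [PiNat.res_eq_res] at hy ⊢
      exact fun m hm => hy (hm.trans (Nat.lt_succ_self n))
  have hiff : ∀ i, x ∈ (⋃ m, E i m) ↔
      ∃ N, ∀ n ≥ N, μ i (PiNat.res x (n + 1)) = μ i (PiNat.res x n) := by
    intro i
    constructor
    · intro hx
      obtain ⟨m, hm⟩ := mem_iUnion.1 hx
      have hb : ∀ n, μ i (PiNat.res x n) ≤ m := fun n =>
        Nat.sInf_le (Or.inr ⟨x, hm, by rw [PiNat.res_length]⟩)
      obtain ⟨N, hN⟩ : ∃ N, ∀ n, μ i (PiNat.res x n) ≤ μ i (PiNat.res x N) := by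
        have hfin : (Set.range fun n => μ i (PiNat.res x n)).Finite :=
          (Set.finite_Iic m).subset (by rintro _ ⟨n, rfl⟩; exact hb n)
        obtain ⟨_, ⟨N, rfl⟩, hN⟩ := Set.exists_max_image _ id hfin (Set.range_nonempty _)
        exact ⟨N, fun n => hN _ ⟨n, rfl⟩⟩
      refine ⟨N, fun n hn => ?_⟩
      have h1 := hmono i hn
      have h2 := hmono i (Nat.le_succ n)
      have h3 := hN (n + 1)
      simp only [Nat.succ_eq_add_one] at h1 h2
      omega
    · rintro ⟨N, hN⟩
      have hc : ∀ n ≥ N, μ i (PiNat.res x n) = μ i (PiNat.res x N) := by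
        intro n hn
        induction n, hn using Nat.le_induction with
        | base => rfl
        | succ n hn ih => rw [hN n hn, ih]
      refine mem_iUnion.2 ⟨μ i (PiNat.res x N), closed_mem_of_cyl (hE _ _) fun n => ?_⟩
      have h1 := hc (max n (max N (μ i (PiNat.res x N) + 1)))
        ((le_max_left _ _).trans (le_max_right _ _))
      rcases hμmem i (PiNat.res x (max n (max N (μ i (PiNat.res x N) + 1)))) with h | ⟨y, hyE, hy⟩
      · rw [h1, PiNat.res_length] at h
        have := (le_max_right N (μ i (PiNat.res x N) + 1)).trans (le_max_right n _)
        omega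
      · rw [h1] at hyE
        rw [PiNat.res_length, PiNat.res_eq_res] at hy
        exact ⟨y, fun m hm => hy (lt_of_lt_of_le hm (le_max_left _ _)), hyE⟩
  have htail : ∀ n, (PiNat.res x (n + 1)).tail = PiNat.res x n := fun n => rfl
  rw [hY, tendsto_atTop_atTop]
  simp only [mem_iInter, hiff]
  constructor
  · intro h b
    choose N hN using h
    refine ⟨max b ((Finset.range b).sup N), fun n hn => ?_⟩
    by_contra hlt
    push Not at hlt
    rcases hφmem (PiNat.res x (n + 1)) with h | h
    · rw [htail, PiNat.res_length] at h
      have := (le_max_left b _).trans hn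
      omega
    · apply h
      rw [htail]
      apply hN
      exact (Finset.le_sup (f := N) (Finset.mem_range.2 hlt)).trans ((le_max_right _ _).trans hn)
  · intro h i
    obtain ⟨N, hN⟩ := h (i + 1)
    refine ⟨N, fun n hn => ?_⟩
    by_contra hne
    have h1 : φ (PiNat.res x (n + 1)) ≤ i := Nat.sInf_le (Or.inr (by rw [htail]; exact hne))
    have := hN n hn
    omega

/-! ### The construction -/

/-- States of the construction. -/
structure St (T : Type u) where
  /-- the current clopen set -/
  V : Set (ℕ → T)
  /-- the current closed sets -/
  F : ℕ → Set (ℕ → T)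

/-- The invariant at stage `n`. -/
structure Inv (k : Cardinal.{u}) (X : Set (ℕ → T)) (E : ℕ → ℕ → Set (ℕ → T)) (n : ℕ)
    (s : St T) : Prop where
  clopen : IsClopen s.V
  good : ∀ i, Good k X (s.F i)
  anti : Antitone s.F
  meets : ∀ i, (s.V ∩ s.F i).Nonempty
  level : ∀ i ≤ n, s.F i ⊆ ⋃ m, E i m
  diam : ∃ x, s.V ⊆ cyl x n

open Classical in
/-- Open sets witnessing density of a `G_δ`-set disjoint from `X`. -/
def Ok (k : Cardinal.{u}) (X : Set (ℕ → T)) (K : Set (ℕ → T)) : ℕ → Set (ℕ → T) :=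
  if h : Good k X K then Classical.choose h.dense else fun _ => univ

lemma Ok_spec {K : Set (ℕ → T)} (h : Good k X K) :
    (∀ n, IsOpen (Ok k X K n)) ∧ Antitone (Ok k X K) ∧ Disjoint (⋂ n, Ok k X K n) X ∧
    ∀ x ∈ K, ∀ n, ((⋂ n, Ok k X K n) ∩ K ∩ cyl x n).Nonempty := by
  unfold Ok
  rw [dif_pos h]
  exact Classical.choose_spec h.dense

/-- The relation between a state and its successors. -/
structure StepRel (k : Cardinal.{u}) (X : Set (ℕ → T)) (n : ℕ) (p : T → ℕ) (s : St T)
    (s' : T → St T) : Prop where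
  sub : ∀ a, (s' a).V ⊆ s.V
  disj : ∀ a b, ((s' a).V ∩ (s' b).V).Nonempty → a = b
  closed : IsClosed (⋃ a, (s' a).V)
  keep : ∀ a, ∀ j ≤ p a, (s' a).F j = s.F j
  hit : ∀ a, (s' a).V ⊆ Ok k X (s.F (p a)) n
  room : ∀ _ : T, ∃ x ∈ X, x ∈ s.V ∧ ∀ b, x ∉ (s' b).V

lemma step (hT : Nonempty (T ≃ Bool) ∨ Cardinal.aleph0 < k ∧ Cardinal.mk T ≤ k)
    {E : ℕ → ℕ → Set (ℕ → T)} (hE : ∀ n m, IsClosed (E n m)) (hX : X = ⋂ n, ⋃ m, E n m)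
    {n : ℕ} {s : St T} (hs : Inv k X E n s) {p : T → ℕ} (hp : ∀ a, p a ≤ n) :
    ∃ s' : T → St T, (∀ a, Inv k X E (n + 1) (s' a)) ∧ StepRel k X n p s s' := by
  classical
  obtain ⟨W, hW⟩ := split hT (hs.good n) hs.clopen (hs.meets n)
  have key : ∀ a, ∃ s' : St T, Inv k X E (n + 1) s' ∧ s'.V ⊆ W a ∧
      (∀ j ≤ p a, s'.F j = s.F j) ∧ s'.V ⊆ Ok k X (s.F (p a)) n ∧ ∃ x ∈ X, x ∈ W a ∧ x ∉ s'.V := by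
    intro a
    set K := s.F (p a) with hKdef
    have hK : Good k X K := hs.good _
    have hne : (W a ∩ K).Nonempty := by
      obtain ⟨y, hy, hyF⟩ := hW.meets a
      exact ⟨y, hy, hs.anti (hp a) hyF⟩
    obtain ⟨hO1, hO2, hO3, hO4⟩ := Ok_spec hK
    -- a point of `X`
    obtain ⟨x, hxX, hxW, hxK⟩ : (X ∩ (W a ∩ K)).Nonempty := by
      by_contra hcon
      rw [Set.not_nonempty_iff_eq_empty] at hcon
      refine hK.ns' (hW.clopen a).isOpen hne ?_
      rw [hcon]
      exact Small.of_gdelta IsGδ.empty (empty_subset _)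
    -- a point outside of `X`
    obtain ⟨N, hN⟩ := isOpen_iff_cyl.1 (hW.clopen a).isOpen x hxW
    obtain ⟨y, ⟨hyO, hyK⟩, hyc⟩ := hO4 x hxK N
    have hyW : y ∈ W a := hN hyc
    have hyX : y ∉ X := fun h => Set.disjoint_left.1 hO3 hyO h
    have hyx : y ∈ ({x}ᶜ : Set (ℕ → T)) := by
      rintro rfl
      exact hyX hxX
    obtain ⟨N1, hN1⟩ := isOpen_iff_cyl.1 ((hW.clopen a).isOpen.inter
      ((hO1 n).inter isOpen_compl_singleton)) y ⟨hyW, mem_iInter.1 hyO n, hyx⟩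
    set V' := cyl y (max N1 (n + 1)) with hV'
    have hV'sub : V' ⊆ W a ∩ (Ok k X K n ∩ {x}ᶜ) := (cyl_anti y (le_max_left _ _)).trans hN1
    have hyV' : y ∈ V' := self_mem_cyl y _
    have hV'c : IsClopen V' := ⟨cyl_closed _ _, cyl_open _ _⟩
    obtain ⟨K', hK'sub, hK'ne, hK'g, hK'l⟩ := extract hE hX (F := V' ∩ K)
      (hV'c.isClosed.inter hK.closed) (hK.ns' hV'c.isOpen ⟨y, hyV', hyK⟩) (n + 2)
    refine ⟨⟨V', fun j => if j ≤ p a then s.F j else K'⟩, ⟨hV'c, ?_, ?_, ?_, ?_, ?_⟩,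
      fun z hz => (hV'sub hz).1, fun j hj => by simp [hj], fun z hz => (hV'sub hz).2.1,
      x, hxX, hxW, fun h => (hV'sub h).2.2 rfl⟩
    · intro i
      dsimp only
      split_ifs
      · exact hs.good i
      · exact hK'g
    · intro i j hij
      dsimp only
      by_cases hj : j ≤ p a
      · rw [if_pos hj, if_pos (hij.trans hj)]
        exact hs.anti hij
      · rw [if_neg hj]
        split_ifs with hi
        · exact (hK'sub.trans inter_subset_right).trans (hs.anti hi)
        · exact le_rfl
    · intro i
      dsimp only
      split_ifs with hi
      · exact ⟨y, hyV', hs.anti hi hyK⟩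
      · obtain ⟨z, hz⟩ := hK'ne
        exact ⟨z, (hK'sub hz).1, hz⟩
    · intro i hi
      dsimp only
      split_ifs with hi'
      · exact hs.level i (hi'.trans (hp a))
      · exact hK'l i (by omega)
    · exact ⟨y, cyl_anti y (le_max_right _ _)⟩
  choose s' h1 h2 h3 h4 h5 using key
  refine ⟨s', h1, fun a => (h2 a).trans (hW.sub a), ?_, ?_, h3, h4, ?_⟩
  · rintro a b ⟨x, hxa, hxb⟩
    exact hW.disj a b ⟨x, h2 a hxa, h2 b hxb⟩
  · exact closed_refine (fun a => (hW.clopen a).isOpen) hW.disj hW.closed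
      (fun a => (h1 a).clopen.isClosed) h2
  · intro a
    obtain ⟨x, hxX, hxW, hxV⟩ := h5 a
    refine ⟨x, hxX, hW.sub a hxW, fun b hb => ?_⟩
    have := hW.disj a b ⟨x, hxW, h2 b hb⟩
    subst this
    exact hxV hb

lemma tree_choice {S : Type*} (P : List T → S → Prop) (R : List T → S → (T → S) → Prop) (s0 : S)
    (h0 : P [] s0) (hs : ∀ l s, P l s → ∃ s' : T → S, (∀ a, P (a :: l) (s' a)) ∧ R l s s') :
    ∃ st : List T → S, st [] = s0 ∧ (∀ l, P l (st l)) ∧ ∀ l, R l (st l) (fun a => st (a :: l)) := by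
  have : Nonempty S := ⟨s0⟩
  choose! g hg using hs
  let st : List T → S := fun l => List.rec s0 (fun a l s => g l s a) l
  have hP : ∀ l, P l (st l) := by
    intro l
    induction l with
    | nil => exact h0
    | cons a l ih => exact (hg l (st l) ih).1 a
  exact ⟨st, rfl, hP, fun l => (hg l (st l) (hP l)).2⟩

lemma const_of_step {α : Type*} {f : ℕ → α} {N : ℕ} (h : ∀ n ≥ N, f (n + 1) = f n) :
    ∀ n ≥ N, f n = f N := by
  intro n hn
  induction n, hn using Nat.le_induction with
  | base => rfl
  | succ n hn ih => rw [h n hn, ih]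

theorem main (hT : Nonempty (T ≃ Bool) ∨ Cardinal.aleph0 < k ∧ Cardinal.mk T ≤ k)
    {E : ℕ → ℕ → Set (ℕ → T)} (hE : ∀ n m, IsClosed (E n m)) (hX : X = ⋂ n, ⋃ m, E n m)
    {E' : ℕ → ℕ → Set (ℕ → T)} (hE' : ∀ n m, IsClosed (E' n m)) {Y : Set (ℕ → T)}
    (hY : Y = ⋂ n, ⋃ m, E' n m) (hns : ¬ Small k X X) :
    ∃ h : (ℕ → T) → (ℕ → T), IsClosedEmbedding h ∧ (∀ x, h x ∈ X ↔ x ∈ Y) ∧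
      ∀ y n, ∃ x ∈ X, x ∈ cyl (h y) n ∧ x ∉ Set.range h := by
  obtain ⟨φ, hφ, hφY⟩ := coding hE' hY
  obtain ⟨K0, -, hK0n, hK0g, hK0l⟩ := extract (k := k) hE hX isClosed_univ
    (by simpa using hns) 1
  obtain ⟨x0, hx0⟩ := hK0n
  obtain ⟨st, hst0, hI, hR⟩ := tree_choice (T := T) (fun l s => Inv k X E l.length s)
    (fun l s s' => StepRel k X l.length (fun a => φ (a :: l)) s s')
    ⟨univ, fun _ => K0⟩
    ⟨isClopen_univ, fun _ => hK0g, fun _ _ _ => le_rfl, fun _ => ⟨x0, trivial, hx0⟩,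
      fun i hi => hK0l i (by simpa using Nat.lt_succ_of_le hi),
      ⟨x0, fun _ _ i hi => (Nat.not_lt_zero i hi).elim⟩⟩
    (fun l s hs => step hT hE hX hs (fun a => hφ a l))
  -- disjointness
  have hdisj : ∀ l l' : List T, l.length = l'.length → ((st l).V ∩ (st l').V).Nonempty → l = l' := by
    intro l
    induction l with
    | nil =>
      intro l' hl _
      exact (List.length_eq_zero_iff.1 hl.symm).symm
    | cons a l ih =>
      intro l' hl hne
      cases l' with
      | nil => simp at hl
      | cons b l' =>
        obtain ⟨x, hx, hx'⟩ := hne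
        have : l = l' := ih l' (by simpa using hl) ⟨x, (hR l).sub a hx, (hR l').sub b hx'⟩
        subst this
        rw [(hR l).disj a b ⟨x, hx, hx'⟩]
  have hVanti : ∀ x : ℕ → T, Antitone fun n => (st (PiNat.res x n)).V := fun x =>
    antitone_nat_of_succ_le fun n => (hR (PiNat.res x n)).sub (x n)
  have hdiam : ∀ (x : ℕ → T) n, ∃ c, (st (PiNat.res x n)).V ⊆ cyl c n := by
    intro x n
    obtain ⟨c, hc⟩ := (hI (PiNat.res x n)).diam
    rw [PiNat.res_length] at hc
    exact ⟨c, hc⟩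
  choose c hc using hdiam
  let h : (ℕ → T) → (ℕ → T) := fun x i => c x (i + 1) i
  have hmem : ∀ x n, h x ∈ (st (PiNat.res x n)).V := by
    intro x n
    refine closed_mem_of_cyl (hI _).clopen.isClosed fun m => ?_
    obtain ⟨p, hp, -⟩ := (hI (PiNat.res x (max n m))).meets 0
    refine ⟨p, fun i hi => ?_, hVanti x (le_max_left n m) hp⟩
    have h1 : p ∈ (st (PiNat.res x (i + 1))).V :=
      hVanti x ((Nat.succ_le_of_lt hi).trans (le_max_right n m)) hp
    exact hc x (i + 1) h1 i (Nat.lt_succ_self i)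
  have hsub : ∀ x n, (st (PiNat.res x n)).V ⊆ cyl (h x) n := by
    intro x n
    rw [cyl_eq (hc x n (hmem x n)) le_rfl]
    exact hc x n
  have huniq : ∀ x p, (∀ n, p ∈ (st (PiNat.res x n)).V) → p = h x := by
    intro x p hp
    funext i
    exact hsub x (i + 1) (hp (i + 1)) i (Nat.lt_succ_self i)
  have hback : ∀ x y n, h y ∈ (st (PiNat.res x n)).V → y ∈ cyl x n := by
    intro x y n hy
    rw [← res_mem]
    exact hdisj _ _ (by simp) ⟨h y, hmem y n, hy⟩
  have hcont : Continuous h := by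
    rw [continuous_def]
    intro U hU
    rw [isOpen_iff_cyl]
    intro x hx
    obtain ⟨n, hn⟩ := isOpen_iff_cyl.1 hU (h x) hx
    refine ⟨n, fun y hy => hn (hsub x n ?_)⟩
    rw [← res_mem.2 hy]
    exact hmem y n
  have hinj : Function.Injective h := by
    intro x y hxy
    funext i
    refine (hback x y (i + 1) ?_ i (Nat.lt_succ_self i)).symm
    rw [← hxy]
    exact hmem x _
  have hclosed : IsClosedMap h := by
    intro C hC
    refine isClosed_of_closure_subset fun p hp => ?_
    have hnext : ∀ l : {l : List T // p ∈ (st l).V}, ∃ a, p ∈ (st (a :: l.1)).V := by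
      rintro ⟨l, hl⟩
      have h1 : p ∈ closure (⋃ a, (st (a :: l)).V) := by
        rw [mem_closure_iff_nhds] at hp ⊢
        intro t ht
        obtain ⟨q, ⟨hqt, hqV⟩, x, hx, rfl⟩ :=
          hp _ (Filter.inter_mem ht ((hI l).clopen.isOpen.mem_nhds hl))
        have h2 : PiNat.res x l.length = l :=
          hdisj _ _ (by simp) ⟨h x, hmem x _, hqV⟩
        have h3 := hmem x (l.length + 1)
        rw [PiNat.res_succ, h2] at h3
        exact ⟨h x, hqt, mem_iUnion.2 ⟨_, h3⟩⟩
      rw [(hR l).closed.closure_eq] at h1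
      exact mem_iUnion.1 h1
    choose f hf using hnext
    have hp0 : p ∈ (st []).V := by rw [hst0]; trivial
    let L : ℕ → {l : List T // p ∈ (st l).V} := fun n =>
      Nat.rec ⟨[], hp0⟩ (fun _ l => ⟨f l :: l.1, hf l⟩) n
    let z : ℕ → T := fun n => f (L n)
    have hz : ∀ n, PiNat.res z n = (L n).1 := by
      intro n
      induction n with
      | zero => rfl
      | succ n ih => rw [PiNat.res_succ, ih]
    have hpz : ∀ n, p ∈ (st (PiNat.res z n)).V := by
      intro n
      rw [hz]
      exact (L n).2
    have hpe := huniq z p hpz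
    refine ⟨z, closed_mem_of_cyl hC fun n => ?_, hpe.symm⟩
    obtain ⟨q, hq, x, hx, rfl⟩ := mem_closure_iff_nhds.1 hp _
      ((hI _).clopen.isOpen.mem_nhds (hpz n))
    exact ⟨x, hback z x n hq, hx⟩
  have hkeep : ∀ x i N, (∀ n ≥ N, i ≤ φ (PiNat.res x (n + 1))) →
      ∀ n ≥ N, (st (PiNat.res x n)).F i = (st (PiNat.res x N)).F i := by
    intro x i N hN
    refine const_of_step (f := fun n => (st (PiNat.res x n)).F i) fun n hn => ?_
    exact (hR (PiNat.res x n)).keep (x n) i (hN n hn)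
  refine ⟨h, Topology.IsClosedEmbedding.of_continuous_injective_isClosedMap hcont hinj hclosed,
    ?_, ?_⟩
  · intro x
    constructor
    · intro hxX
      by_contra hxY
      rw [hφY, tendsto_atTop_atTop] at hxY
      push Not at hxY
      have hex : ∃ b, ∀ N, ∃ n ≥ N, φ (PiNat.res x (n + 1)) ≤ b := by
        obtain ⟨b, hb⟩ := hxY
        refine ⟨b, fun N => ?_⟩
        obtain ⟨n, hn, hn'⟩ := hb N
        exact ⟨n, hn, hn'.le⟩
      classical
      set b := Nat.find hex with hb
      have hb1 := Nat.find_spec hex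
      have hb2 : ∃ N, ∀ n ≥ N, b ≤ φ (PiNat.res x (n + 1)) := by
        by_cases hb0 : b = 0
        · exact ⟨0, fun n _ => by omega⟩
        · have := Nat.find_min hex (m := b - 1) (by omega)
          push Not at this
          obtain ⟨N, hN⟩ := this
          exact ⟨N, fun n hn => by have := hN n hn; omega⟩
      obtain ⟨N, hN⟩ := hb2
      have hG := (hI (PiNat.res x N)).good b
      obtain ⟨-, hO2, hO3, -⟩ := Ok_spec hG
      refine Set.disjoint_left.1 hO3 (mem_iInter.2 fun m => ?_) hxX
      obtain ⟨n, hn, hnb⟩ := hb1 (max N m)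
      have hnN : N ≤ n := (le_max_left _ _).trans hn
      have heq : φ (PiNat.res x (n + 1)) = b := le_antisymm hnb (hN n hnN)
      have hhit := (hR (PiNat.res x n)).hit (x n) (hmem x (n + 1))
      have heq' : φ (x n :: PiNat.res x n) = b := heq
      simp only [heq', PiNat.res_length] at hhit
      rw [hkeep x b N hN n hnN] at hhit
      exact hO2 ((le_max_right _ _).trans hn) hhit
    · intro hxY
      rw [hφY, tendsto_atTop_atTop] at hxY
      rw [hX]
      refine mem_iInter.2 fun i => ?_
      obtain ⟨N, hN⟩ := hxY i
      have hN' : ∀ n ≥ max N i, i ≤ φ (PiNat.res x (n + 1)) :=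
        fun n hn => hN n ((le_max_left _ _).trans hn)
      have hk' := hkeep x i _ hN'
      refine (hI (PiNat.res x (max N i))).level i (by simp) ?_
      refine closed_mem_of_cyl ((hI (PiNat.res x (max N i))).good i).closed fun n => ?_
      obtain ⟨p, hp1, hp2⟩ := (hI (PiNat.res x (max n (max N i)))).meets i
      rw [hk' _ (le_max_right _ _)] at hp2
      exact ⟨p, cyl_anti _ (le_max_left _ _) (hsub x _ hp1), hp2⟩
  · intro y n
    obtain ⟨x, hxX, hxV, hx⟩ := (hR (PiNat.res y n)).room (y n)
    refine ⟨x, hxX, hsub y n hxV, ?_⟩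
    rintro ⟨z, rfl⟩
    have h2 : PiNat.res z n = PiNat.res y n := res_mem.2 (hback y z n hxV)
    apply hx (z n)
    have := hmem z (n + 1)
    rwa [PiNat.res_succ, h2] at this

/-! ### From smallness to the topological class -/

lemma gdelta_range {Z W : Type*} [TopologicalSpace Z] [TopologicalSpace W]
    [TopologicalSpace.MetrizableSpace W] {g : Z → (ℕ → T)} (hg : IsInducing g)
    (hG : IsGδ (Set.range g)) {f : Z → W} (hf : IsEmbedding f) : IsGδ (Set.range f) := by
  obtain ⟨O, hO, hOe⟩ := isGδ_iff_eq_iInter_nat.1 hG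
  let U : ℕ → Set W := fun n =>
    ⋃₀ {V | IsOpen V ∧ ∃ x m, n ≤ m ∧ cyl x m ⊆ O n ∧ ∀ z, f z ∈ V → g z ∈ cyl x m}
  have hU : ∀ n, IsOpen (U n) := fun n => isOpen_sUnion fun V hV => hV.1
  have key : Set.range f = closure (Set.range f) ∩ ⋂ n, U n := by
    apply Subset.antisymm
    · rintro _ ⟨z, rfl⟩
      refine ⟨subset_closure ⟨z, rfl⟩, mem_iInter.2 fun n => ?_⟩
      have hz : g z ∈ O n := by
        have : g z ∈ Set.range g := ⟨z, rfl⟩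
        rw [hOe] at this
        exact mem_iInter.1 this n
      obtain ⟨m, hm⟩ := isOpen_iff_cyl.1 (hO n) _ hz
      have ho : IsOpen (g ⁻¹' cyl (g z) (max n m)) := (cyl_open _ _).preimage hg.continuous
      obtain ⟨V, hV, hVe⟩ := hf.isInducing.isOpen_iff.1 ho
      have hmemV : ∀ z', f z' ∈ V ↔ g z' ∈ cyl (g z) (max n m) := by
        intro z'
        have : z' ∈ f ⁻¹' V ↔ z' ∈ g ⁻¹' cyl (g z) (max n m) := by rw [hVe]
        exact this
      exact ⟨V, ⟨hV, g z, max n m, le_max_left _ _, (cyl_anti _ (le_max_right _ _)).trans hm,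
        fun z' h => (hmemV z').1 h⟩, (hmemV z).2 (self_mem_cyl _ _)⟩
    · rintro y ⟨hycl, hyU⟩
      have h1 : ∀ n, ∃ V, IsOpen V ∧ y ∈ V ∧ ∃ x m, n ≤ m ∧ cyl x m ⊆ O n ∧
          ∀ z, f z ∈ V → g z ∈ cyl x m := by
        intro n
        obtain ⟨V, ⟨hV, h⟩, hy⟩ := mem_iInter.1 hyU n
        exact ⟨V, hV, hy, h⟩
      choose V hVo hyV x m hnm hxO hVg using h1
      let b : ℕ → T := fun i => x (i + 1) i
      have hb : ∀ n, b ∈ cyl (x n) (m n) := by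
        intro n i hi
        obtain ⟨_, ⟨hw1, hw2⟩, z, rfl⟩ := mem_closure_iff.1 hycl (V n ∩ V (i + 1))
          ((hVo n).inter (hVo (i + 1))) ⟨hyV n, hyV (i + 1)⟩
        have e1 := hVg n z hw1 i hi
        have e2 := hVg (i + 1) z hw2 i (hnm (i + 1))
        exact e2.symm.trans e1
      have hbr : b ∈ Set.range g := by
        rw [hOe]
        exact mem_iInter.2 fun n => hxO n (hb n)
      obtain ⟨z, hz⟩ := hbr
      have hne : (comap f (𝓝 y)).NeBot := by
        rw [Filter.comap_neBot_iff]
        intro t ht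
        obtain ⟨_, hw, z', rfl⟩ := mem_closure_iff_nhds.1 hycl t ht
        exact ⟨z', hw⟩
      have hle : comap f (𝓝 y) ≤ 𝓝 z := by
        rw [hg.nhds_eq_comap, ← Filter.map_le_iff_le_comap]
        intro s hs
        obtain ⟨s', hs's, hs'o, hzs'⟩ := mem_nhds_iff.1 hs
        rw [hz] at hzs'
        obtain ⟨n, hn⟩ := isOpen_iff_cyl.1 hs'o b hzs'
        rw [Filter.mem_map, Filter.mem_comap]
        refine ⟨V n, (hVo n).mem_nhds (hyV n), fun z' hz' => hs's (hn ?_)⟩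
        rw [cyl_eq (hb n) (hnm n)]
        exact cyl_anti _ (hnm n) (hVg n z' hz')
      have t1 : Tendsto f (comap f (𝓝 y)) (𝓝 (f z)) := (hf.continuous.tendsto z).mono_left hle
      exact ⟨z, tendsto_nhds_unique t1 tendsto_comap⟩
  rw [key]
  letI := TopologicalSpace.metrizableSpaceMetric W
  exact isClosed_closure.isGδ.inter (IsGδ.iInter_of_isOpen hU)

lemma weight_of_few {Z : Type u} [TopologicalSpace Z] {g : Z → (ℕ → T)} (hg : IsInducing g)
    (h : Few k (Set.range g)) : WeightLT Z k := by
  refine ⟨(fun l : List T => g ⁻¹' {x | PiNat.res x l.length ∈ ({l} : Set (List T))}) ''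
    pieces (Set.range g), ?_, lt_of_le_of_lt Cardinal.mk_image_le h⟩
  apply TopologicalSpace.isTopologicalBasis_of_isOpen_of_nhds
  · rintro _ ⟨l, -, rfl⟩
    exact (level_clopen _ _).isOpen.preimage hg.continuous
  · intro z u hz hu
    obtain ⟨V, hV, rfl⟩ := hg.isOpen_iff.1 hu
    obtain ⟨n, hn⟩ := isOpen_iff_cyl.1 hV (g z) hz
    refine ⟨_, ⟨PiNat.res (g z) n, mem_iUnion.2 ⟨n, g z, ⟨z, rfl⟩, rfl⟩, rfl⟩, ?_, ?_⟩
    · change PiNat.res (g z) (PiNat.res (g z) n).length = PiNat.res (g z) n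
      rw [PiNat.res_length]
    · intro z' hz'
      have h1 : PiNat.res (g z') (PiNat.res (g z) n).length = PiNat.res (g z) n := hz'
      rw [PiNat.res_length] at h1
      exact hn (res_mem.1 h1)

lemma slw_of_small (h : Small k X X) : SLWplusGDS ↥X k := by
  obtain ⟨L, G, hL, hG, hsub⟩ := h
  refine ⟨{x | x.1 ∈ ⋃ n, L n}, {x | x.1 ∈ ⋃ n, G n}, ?_, ?_, ?_⟩
  · ext x
    simp only [mem_univ, iff_true]
    exact hsub x.2
  · refine ⟨fun n => {x | x.1.1 ∈ L n}, ?_, ?_⟩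
    · ext ⟨x, hx⟩
      simp only [mem_univ, iff_true]
      obtain ⟨n, hn⟩ := mem_iUnion.1 hx
      exact mem_iUnion.2 ⟨n, hn⟩
    · rintro n ⟨x, hx⟩
      obtain ⟨N, hN⟩ := hL n x.1.1 hx
      refine ⟨{y | y.1.1.1 ∈ cyl x.1.1 N}, ?_, ?_⟩
      · refine IsOpen.mem_nhds ?_ (self_mem_cyl _ _)
        exact (cyl_open x.1.1 N).preimage
          (continuous_subtype_val.comp (continuous_subtype_val.comp continuous_subtype_val))
      · refine weight_of_few (g := fun y => y.1.1.1.1) ?_ (hN.mono ?_)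
        · exact IsInducing.subtypeVal.comp (IsInducing.subtypeVal.comp
            (IsInducing.subtypeVal.comp IsInducing.subtypeVal))
        · rintro _ ⟨y, rfl⟩
          exact ⟨y.1.2, y.2⟩
  · refine ⟨inferInstance, ?_⟩
    intro Y _ _ f hf
    refine ⟨fun n => f '' {x | x.1.1 ∈ G n}, fun n => ?_, ?_⟩
    · have h1 : f '' {x | x.1.1 ∈ G n} =
          Set.range (fun y : {x : {x : ↥X | x.1 ∈ ⋃ n, G n} | x.1.1 ∈ G n} => f y.1) := by
        ext w
        constructor
        · rintro ⟨x, hx, rfl⟩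
          exact ⟨⟨x, hx⟩, rfl⟩
        · rintro ⟨x, rfl⟩
          exact ⟨x.1, x.2, rfl⟩
      beta_reduce
      rw [h1]
      refine gdelta_range (T := T) (g := fun y => y.1.1.1) ?_ ?_ (hf.comp IsEmbedding.subtypeVal)
      · exact IsInducing.subtypeVal.comp (IsInducing.subtypeVal.comp IsInducing.subtypeVal)
      · convert (hG n).1 using 1
        ext x
        constructor
        · rintro ⟨y, rfl⟩
          exact y.2
        · intro hx
          exact ⟨⟨⟨⟨x, (hG n).2 hx⟩, mem_iUnion.2 ⟨n, hx⟩⟩, hx⟩, rfl⟩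
    · ext w
      simp only [mem_iUnion]
      constructor
      · rintro ⟨⟨x, hx⟩, rfl⟩
        obtain ⟨n, hn⟩ := mem_iUnion.1 hx
        exact ⟨n, ⟨x, hx⟩, hn, rfl⟩
      · rintro ⟨n, x, -, rfl⟩
        exact ⟨x, rfl⟩

lemma fsd_family {X : Set (ℕ → T)} (h : IsFsigmaDelta X) :
    ∃ E : ℕ → ℕ → Set (ℕ → T), (∀ n m, IsClosed (E n m)) ∧ X = ⋂ n, ⋃ m, E n m := by
  obtain ⟨F, hF, rfl⟩ := h
  choose E hE hEe using hF
  exact ⟨E, hE, iInter_congr hEe⟩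

theorem final (hT : Nonempty (T ≃ Bool) ∨ Cardinal.aleph0 < k ∧ Cardinal.mk T ≤ k)
    (X Y : Set (ℕ → T)) (hX : IsFsigmaDelta X) (hY : IsFsigmaDelta Y)
    (hnot : ¬ SLWplusGDS ↥X k) :
    ∃ F : Set ↥X, IsClosed F ∧ IsNowhereDense F ∧ Nonempty (↥F ≃ₜ ↥Y) := by
  obtain ⟨E, hE, hXE⟩ := fsd_family hX
  obtain ⟨E', hE', hYE⟩ := fsd_family hY
  obtain ⟨h, hh, hXY, hroom⟩ := main (k := k) hT hE hXE hE' hYE fun hs => hnot (slw_of_small hs)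
  have hcl : IsClosed {x : ↥X | x.1 ∈ Set.range h} :=
    hh.isClosed_range.preimage continuous_subtype_val
  refine ⟨{x | x.1 ∈ Set.range h}, hcl, ?_, ?_⟩
  · rw [hcl.isNowhereDense_iff, Set.eq_empty_iff_forall_notMem]
    intro p hp
    obtain ⟨U, hU, hUo, hpU⟩ := mem_interior.1 hp
    obtain ⟨V, hV, rfl⟩ := isOpen_induced_iff.1 hUo
    obtain ⟨y, hy⟩ := hU hpU
    have hyV : h y ∈ V := by rw [hy]; exact hpU
    obtain ⟨n, hn⟩ := isOpen_iff_cyl.1 hV _ hyV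
    obtain ⟨x, hxX, hxc, hxr⟩ := hroom y n
    exact hxr (hU (show (⟨x, hxX⟩ : ↥X) ∈ Subtype.val ⁻¹' V from hn hxc))
  · let g : ↥Y → ↥X := fun y => ⟨h y.1, (hXY y.1).2 y.2⟩
    have hg : IsEmbedding g := by
      have h1 : IsEmbedding (fun y : ↥Y => h y.1) := hh.isEmbedding.comp IsEmbedding.subtypeVal
      exact IsEmbedding.of_comp (by fun_prop) continuous_subtype_val h1
    have hr : Set.range g = {x : ↥X | x.1 ∈ Set.range h} := by
      ext ⟨x, hx⟩
      constructor
      · rintro ⟨y, hy⟩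
        exact ⟨y.1, congrArg Subtype.val hy⟩
      · rintro ⟨y, hy⟩
        have hy' : h y = x := hy
        exact ⟨⟨y, (hXY y).1 (by rw [hy']; exact hx)⟩, Subtype.ext hy'⟩
    rw [← hr]
    exact ⟨hg.toHomeomorph.symm⟩

end basics

end HW

/-- Corollary `c-f2`: `X` contains a nowhere dense closed copy of any
`F_σδ`-subset `Y` of `B*(k)`. -/
theorem stmt_15 (k : Cardinal.{u}) (hk : Cardinal.aleph0 ≤ k)
    (X Y : Set (BaireStar k)) (hX : IsFsigmaDelta X) (hY : IsFsigmaDelta Y)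
    (hnot : ¬ SLWplusGDS ↥X k) :
    ∃ F : Set ↥X, IsClosed F ∧ IsNowhereDense F ∧ Nonempty (↥F ≃ₜ ↥Y) := by
  refine HW.final (T := StarT k) (k := k) ?_ X Y hX hY hnot
  by_cases h : k = Cardinal.aleph0
  · left
    have : StarT k = ULift Bool := by unfold StarT; rw [if_pos h]
    exact ⟨(Equiv.cast this).trans Equiv.ulift⟩
  · right
    refine ⟨lt_of_le_of_ne hk (Ne.symm h), ?_⟩
    have : StarT k = DiscT k := by unfold StarT; rw [if_neg h]
    rw [this]
    exact (Cardinal.mk_out k).le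
end
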